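/- arXiv:2403.05355 — 9 statements merged into one kernel-verified Lean document; each statement's English description precedes it below -/
import Mathlib

section
/- The quotient ring P/I is an integral domain. (This is the algebraic content of the paper's Theorem on the representation-graded Bredon homology ring H(A,★) of an elementary abelian 2-group of rank r: H(A,★) is a domain and is presented as the quotient of the polynomial algebra on the pre-Euler classes a_λ and inverse Thom classes t_λ by the ideal generated by the relations r(T) for all minimally dependent sets T of nontrivial characters.) -/
open MvPolynomial

/-- The rank-`r` elementary abelian 2-group's character vector space `W = F₂^r`. -/
abbrev W (r : ℕ) : Type := Fin r → ZMod 2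

/-- The set of nonzero vectors of `W r` (nontrivial characters). -/
abbrev Chi (r : ℕ) : Type := {w : W r // w ≠ 0}

/-- A finite set of nonzero vectors is minimally dependent if it is linearly dependent
but every proper subset is linearly independent. -/
def MinDep {r : ℕ} (T : Finset (Chi r)) : Prop :=
  (¬ LinearIndependent (ZMod 2) (fun x : (T : Set (Chi r)) => (x : Chi r).val)) ∧
  ∀ S : Finset (Chi r), S ⊂ T →
    LinearIndependent (ZMod 2) (fun x : (S : Set (Chi r)) => (x : Chi r).val)

/-- The relation polynomial `r(T) = ∑_{λ∈T} a_λ ∏_{μ∈T\{λ}} t_μ` in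
`P = F₂[a_λ, t_λ]` with `a_λ = X (Sum.inl λ)`, `t_λ = X (Sum.inr λ)`. -/
noncomputable def rpoly {r : ℕ} (T : Finset (Chi r)) :
    MvPolynomial (Chi r ⊕ Chi r) (ZMod 2) :=
  ∑ lam ∈ T, X (Sum.inl lam) * ∏ mu ∈ T.erase lam, X (Sum.inr mu)

/-- The ideal generated by the relations `r(T)` for all minimally dependent `T`. -/
noncomputable def relIdeal (r : ℕ) : Ideal (MvPolynomial (Chi r ⊕ Chi r) (ZMod 2)) :=
  Ideal.span {p | ∃ T : Finset (Chi r), MinDep T ∧ p = rpoly T}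

section StandardMonomials

variable {K ι : Type*} [Field K]

theorem SymmetricAlgebra.ι_ne_zero {V : Type*} [AddCommGroup V] [Module K V] {x : V}
    (hx : x ≠ 0) : SymmetricAlgebra.ι K V x ≠ 0 := by
  intro h
  refine hx ((Module.forall_dual_apply_eq_zero_iff K x).1 fun f => ?_)
  rw [← SymmetricAlgebra.lift_ι_apply (A := K) f x, h, map_zero]

/-- Products of linear forms of bounded multidegree are linearly independent, provided no form
which occurs in a product lies in the span of the preceding forms of non-maximal exponent. -/
theorem coeff_eq_zero_of_sum_prod_eq_zero (idx : ι → ℕ) (hidx : Function.Injective idx)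
    (d : ι → ℕ) (s : Finset ι) :
    ∀ {V : Type} [AddCommGroup V] [Module K V] (v : ι → V) (F : Finset (ι → ℕ))
      (c : (ι → ℕ) → K),
      (∀ k ∈ F, ∀ i ∈ s, k i ≤ d i) →
      (∀ k ∈ F, ∀ k' ∈ F, ∀ i ∉ s, k i = k' i) →
      (∀ k ∈ F, ∀ e ∈ s, 0 < k e →
        v e ∉ Submodule.span K (v '' {f | f ∈ s ∧ idx f < idx e ∧ k f < d f})) →
      ∑ k ∈ F, c k • ∏ e ∈ s, SymmetricAlgebra.ι K V (v e) ^ k e = 0 →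
      ∀ k ∈ F, c k = 0 := by
  classical
  induction s using Finset.induction_on_min_value idx with
  | empty =>
    intro V _ _ v F c _ hF _ hsum k hk
    have : F = {k} := by
      refine Finset.eq_singleton_iff_unique_mem.2 ⟨hk, fun k' hk' => ?_⟩
      exact funext fun i => hF k' hk' k hk i (by simp)
    simpa [this] using hsum
  | insert a s ha hmin ih =>
    intro V _ _ v F c hd hF hstd hsum
    have hlt : ∀ x ∈ s, idx a < idx x := fun x hx =>
      lt_of_le_of_ne (hmin x hx) fun h => ha (hidx h ▸ hx)
    suffices H : ∀ m, ∀ k ∈ F, k a = m → c k = 0 from fun k hk => H _ k hk rfl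
    intro m
    induction m using Nat.strong_induction_on with
    | _ m ihm =>
    by_cases hum : v a = 0 ∧ 0 < m
    · intro k hk hka
      exact absurd (hum.1 ▸ Submodule.zero_mem _)
        (hstd k hk a (Finset.mem_insert_self _ _) (hka ▸ hum.2))
    have hu : SymmetricAlgebra.ι K V (v a) ^ m ≠ 0 := by
      rcases Nat.eq_zero_or_pos m with rfl | hm
      · simp
      · exact pow_ne_zero _ (SymmetricAlgebra.ι_ne_zero fun h => hum ⟨h, hm⟩)
    have hsum' : ∑ k ∈ F with m ≤ k a, c k • (SymmetricAlgebra.ι K V (v a) ^ (k a - m) *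
        ∏ e ∈ s, SymmetricAlgebra.ι K V (v e) ^ k e) = 0 := by
      refine (mul_eq_zero.1 ?_).resolve_left hu
      rw [← hsum, Finset.mul_sum, Finset.sum_filter]
      refine Finset.sum_congr rfl fun k hk => ?_
      split_ifs with h
      · rw [Finset.prod_insert ha, mul_smul_comm, ← mul_assoc, ← pow_add,
          Nat.add_sub_cancel' h]
      · rw [ihm (k a) (not_le.1 h) k hk rfl, zero_smul]
    have hagree : ∀ k ∈ F.filter (fun k => k a = m), ∀ k' ∈ F.filter (fun k => k a = m),
        ∀ i ∉ s, k i = k' i := by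
      intro k hk k' hk' i hi
      rw [Finset.mem_filter] at hk hk'
      by_cases hia : i = a
      · rw [hia, hk.2, hk'.2]
      · exact hF k hk.1 k' hk'.1 i (by simp [hia, hi])
    have hbound : ∀ k ∈ F.filter (fun k => k a = m), ∀ i ∈ s, k i ≤ d i :=
      fun k hk i hi => hd k (Finset.mem_filter.1 hk).1 i (Finset.mem_insert_of_mem hi)
    have hmono : ∀ (k : ι → ℕ) (e : ι),
        Submodule.span K (v '' {f | f ∈ s ∧ idx f < idx e ∧ k f < d f}) ≤
          Submodule.span K (v '' {f | f ∈ insert a s ∧ idx f < idx e ∧ k f < d f}) :=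
      fun k e => Submodule.span_mono (Set.image_mono fun f hf =>
        ⟨Finset.mem_insert_of_mem hf.1, hf.2⟩)
    intro k hk hka
    by_cases hmd : m < d a
    · let q := (Submodule.span K {v a}).mkQ
      have hq : q (v a) = 0 := by simp [q]
      refine ih (fun e => q (v e)) (F.filter fun k => k a = m) c hbound hagree ?_ ?_ k
        (by simp [hk, hka])
      · intro k hk e he hke hmem
        rw [Finset.mem_filter] at hk
        refine hstd k hk.1 e (Finset.mem_insert_of_mem he) hke ?_
        rw [show (fun e => q (v e)) = q ∘ v from rfl, Set.image_comp,
          ← Submodule.map_span] at hmem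
        obtain ⟨y, hy, hye⟩ := hmem
        have hsub : v e - y ∈ Submodule.span K {v a} := by
          rw [← Submodule.ker_mkQ (Submodule.span K {v a}), LinearMap.mem_ker, map_sub]
          exact sub_eq_zero.2 hye.symm
        rw [← sub_add_cancel (v e) y]
        refine Submodule.add_mem _ (Submodule.span_mono ?_ hsub) (hmono k e hy)
        rw [Set.singleton_subset_iff]
        have hka : k a < d a := hk.2.symm ▸ hmd
        exact Set.mem_image_of_mem v ⟨Finset.mem_insert_self _ _, hlt e he, hka⟩
      · have := congrArg (SymmetricAlgebra.lift (SymmetricAlgebra.ι K _ ∘ₗ q)) hsum'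
        rw [map_zero, map_sum, Finset.sum_filter] at this
        rw [← this, Finset.sum_filter]
        refine Finset.sum_congr rfl fun k hk => ?_
        rcases lt_trichotomy (k a) m with h | h | h
        · rw [if_neg h.ne, if_neg h.not_ge]
        · simp [h]
        · rw [if_neg h.ne', if_pos h.le]
          simp [hq, (Nat.sub_pos_of_lt h).ne']
    · refine ih v (F.filter fun k => k a = m) c hbound hagree ?_ ?_ k (by simp [hk, hka])
      · intro k hk e he hke hmem
        refine hstd k (Finset.mem_filter.1 hk).1 e (Finset.mem_insert_of_mem he) hke ?_
        exact hmono k e hmem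
      · rw [← hsum', Finset.sum_filter, Finset.sum_filter]
        refine Finset.sum_congr rfl fun k hk => ?_
        have := hd k hk a (Finset.mem_insert_self _ _)
        by_cases h : k a = m
        · simp [h]
        · rw [if_neg h, if_neg (by omega)]

end StandardMonomials

section Relations

variable {r : ℕ}

theorem sum_val_eq_zero_of_minDep {T : Finset (Chi r)} (hT : MinDep T) :
    ∑ x ∈ T, x.val = 0 := by
  classical
  obtain ⟨hdep, hmin⟩ := hT
  have hdep' : ¬ LinearIndepOn (ZMod 2) (Subtype.val : Chi r → W r) (T : Set (Chi r)) := hdep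
  rw [linearIndepOn_finset_iff] at hdep'
  push Not at hdep'
  obtain ⟨g, hg, i, hi, hgi⟩ := hdep'
  have hone : ∀ z : ZMod 2, z ≠ 0 → z = 1 := by decide
  have hsum : ∑ x ∈ T with g x ≠ 0, x.val = 0 := by
    rw [Finset.sum_filter]
    refine Eq.trans ?_ hg
    refine Finset.sum_congr rfl fun x _ => ?_
    by_cases h : g x = 0
    · simp [h]
    · simp [hone _ h]
  rcases (Finset.filter_subset (fun x => g x ≠ 0) T).eq_or_ssubset with h | h
  · rwa [h] at hsum
  · have hli : LinearIndepOn (ZMod 2) (Subtype.val : Chi r → W r)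
        ((T.filter fun x => g x ≠ 0 : Finset (Chi r)) : Set (Chi r)) := hmin _ h
    rw [linearIndepOn_finset_iff] at hli
    exact absurd (hli (fun _ => 1) (by simpa using hsum) i (by simp [hi, hgi])) one_ne_zero

/-- A vector in the span of a set of other vectors lies in a minimally dependent set. -/
theorem exists_minDep_of_mem_span {e : Chi r} {A : Set (Chi r)} (heA : e ∉ A)
    (he : e.val ∈ Submodule.span (ZMod 2) (Subtype.val '' A)) :
    ∃ S : Finset (Chi r), (S : Set (Chi r)) ⊆ A ∧ e ∉ S ∧ MinDep (insert e S) := by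
  classical
  have hex : ∃ S : Finset (Chi r), (S : Set (Chi r)) ⊆ A ∧
      e.val ∈ Submodule.span (ZMod 2) (Subtype.val '' (S : Set (Chi r))) :=
    ⟨A.toFinite.toFinset, by simp, by simpa using he⟩
  obtain ⟨S, ⟨hSA, hS⟩, hmin⟩ := WellFounded.has_min
    (wellFounded_lt (α := Finset (Chi r))) {S | (S : Set (Chi r)) ⊆ A ∧
      e.val ∈ Submodule.span (ZMod 2) (Subtype.val '' (S : Set (Chi r)))} hex
  have heS : e ∉ S := fun h => heA (hSA h)
  have herase : ∀ x ∈ S, e.val ∉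
      Submodule.span (ZMod 2) (Subtype.val '' ((S.erase x : Finset (Chi r)) : Set (Chi r))) :=
    fun x hx h => hmin _ ⟨fun y hy => hSA (Finset.mem_of_mem_erase hy), h⟩
      (Finset.erase_ssubset hx)
  have hSli : LinearIndepOn (ZMod 2) (Subtype.val : Chi r → W r) (S : Set (Chi r)) := by
    rw [linearIndepOn_iff_notMem_span]
    intro x hx hxs
    refine herase x hx ?_
    rw [Finset.coe_erase]
    refine (Submodule.span_le.2 ?_) hS
    rintro _ ⟨y, hy, rfl⟩
    by_cases hyx : y = x
    · exact hyx ▸ hxs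
    · exact Submodule.subset_span ⟨y, ⟨hy, hyx⟩, rfl⟩
  refine ⟨S, hSA, heS, fun h => ?_, fun S' hS' => ?_⟩
  · have h' : LinearIndepOn (ZMod 2) (Subtype.val : Chi r → W r)
      ((insert e S : Finset (Chi r)) : Set (Chi r)) := h
    rw [Finset.coe_insert, linearIndepOn_insert (by simpa using heS)] at h'
    exact h'.2 hS
  · obtain ⟨x, hxT, hxS'⟩ := Finset.exists_of_ssubset hS'
    have hsub : S' ⊆ (insert e S).erase x := fun y hy =>
      Finset.mem_erase.2 ⟨fun h => hxS' (h ▸ hy), hS'.1 hy⟩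
    suffices h : LinearIndepOn (ZMod 2) (Subtype.val : Chi r → W r)
        (((insert e S).erase x : Finset (Chi r)) : Set (Chi r)) from
      h.mono (Finset.coe_subset.2 hsub)
    by_cases hxe : x = e
    · rwa [hxe, Finset.erase_insert heS]
    · have hxS : x ∈ S := (Finset.mem_insert.1 hxT).resolve_left hxe
      rw [Finset.erase_insert_of_ne (Ne.symm hxe), Finset.coe_insert]
      exact (hSli.mono (Finset.coe_subset.2 (Finset.erase_subset x S))).insert (herase x hxS)

/-- The map sending `t_λ` to itself and `a_λ` to `λ · t_λ`, with `λ` viewed as a linear form. -/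
noncomputable def eulerHom (r : ℕ) : MvPolynomial (Chi r ⊕ Chi r) (ZMod 2) →ₐ[ZMod 2]
    MvPolynomial (Chi r) (SymmetricAlgebra (ZMod 2) (W r)) :=
  aeval (Sum.elim (fun e => C (SymmetricAlgebra.ι (ZMod 2) (W r) e.val) * X e) X)

theorem relIdeal_le_ker_eulerHom : relIdeal r ≤ RingHom.ker (eulerHom r) := by
  classical
  refine Ideal.span_le.2 ?_
  rintro _ ⟨T, hT, rfl⟩
  have h : ∀ e ∈ T, eulerHom r (X (Sum.inl e) * ∏ f ∈ T.erase e, X (Sum.inr f)) =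
      C (SymmetricAlgebra.ι (ZMod 2) (W r) e.val) * ∏ f ∈ T, X f := by
    intro e he
    simp [eulerHom, mul_assoc, Finset.mul_prod_erase T _ he]
  change eulerHom r (rpoly T) = 0
  rw [rpoly, map_sum, Finset.sum_congr rfl h, ← Finset.sum_mul, ← map_sum, ← map_sum,
    sum_val_eq_zero_of_minDep hT, map_zero, map_zero, zero_mul]

theorem eulerHom_monomial (m : Chi r ⊕ Chi r →₀ ℕ) (c : ZMod 2) :
    eulerHom r (monomial m c) =
      monomial (Finsupp.equivFunOnFinite.symm fun e => m (Sum.inl e) + m (Sum.inr e))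
        (c • ∏ e, SymmetricAlgebra.ι (ZMod 2) (W r) e.val ^ m (Sum.inl e)) := by
  classical
  rw [eulerHom, aeval_monomial, Finsupp.prod_fintype _ _ (by simp), Fintype.prod_sum_type]
  simp only [Sum.elim_inl, Sum.elim_inr, mul_pow, Finset.prod_mul_distrib]
  rw [mul_assoc, ← Finset.prod_mul_distrib]
  simp only [← pow_add]
  rw [← smul_monomial, Algebra.smul_def]
  congr 1
  rw [monomial_eq, Finsupp.prod_fintype _ _ (by simp)]
  simp

/-- The exponents whose monomials are divisible by no leading monomial of a relation, where the
leading term of `r(T)` is the one containing `a_λ` with `λ ∈ T` last in the order `idx`. -/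
def IsStandard (idx : Chi r → ℕ) (m : Chi r ⊕ Chi r →₀ ℕ) : Prop :=
  ∀ e, 0 < m (Sum.inl e) → e.val ∉
    Submodule.span (ZMod 2) (Subtype.val '' {f : Chi r | idx f < idx e ∧ 0 < m (Sum.inr f)})

theorem eq_zero_of_isStandard_of_eulerHom_eq_zero {idx : Chi r → ℕ}
    (hidx : Function.Injective idx) {p : MvPolynomial (Chi r ⊕ Chi r) (ZMod 2)}
    (hp : ∀ m ∈ p.support, IsStandard idx m) (h0 : eulerHom r p = 0) : p = 0 := by
  classical
  by_contra hne
  obtain ⟨m₀, hm₀⟩ := Finset.nonempty_of_ne_empty (mt support_eq_empty.1 hne)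
  let deg : (Chi r ⊕ Chi r →₀ ℕ) → Chi r → ℕ := fun m e => m (Sum.inl e) + m (Sum.inr e)
  let ex : (Chi r ⊕ Chi r →₀ ℕ) → Chi r → ℕ := fun m e => m (Sum.inl e)
  let join : (Chi r → ℕ) → (Chi r ⊕ Chi r →₀ ℕ) := fun k =>
    Finsupp.equivFunOnFinite.symm (Sum.elim k fun e => deg m₀ e - k e)
  have hjoin : ∀ m, deg m = deg m₀ → join (ex m) = m := by
    intro m hm
    ext (e | e)
    · simp [join, ex]
    · have : m (Sum.inl e) + m (Sum.inr e) = m₀ (Sum.inl e) + m₀ (Sum.inr e) := congrFun hm e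
      simp [join, ex, deg, ← this]
  let G := p.support.filter fun m => deg m = deg m₀
  have hG : ∀ m ∈ G, join (ex m) = m := fun m hm => hjoin m (Finset.mem_filter.1 hm).2
  have hinj : Set.InjOn ex (G : Set (Chi r ⊕ Chi r →₀ ℕ)) := fun m hm m' hm' h => by
    rw [← hG m hm, ← hG m' hm', h]
  have key := coeff_eq_zero_of_sum_prod_eq_zero (K := ZMod 2) idx hidx (deg m₀) Finset.univ
    (fun e : Chi r => e.val) (G.image ex) (fun k => coeff (join k) p) ?_ ?_ ?_ ?_ (ex m₀) ?_
  · rw [hjoin m₀ rfl] at key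
    exact mem_support_iff.1 hm₀ key
  · rintro _ hk e _
    obtain ⟨m, hm, rfl⟩ := Finset.mem_image.1 hk
    rw [← (Finset.mem_filter.1 hm).2]
    exact Nat.le_add_right _ _
  · simp
  · intro _ hk e _ hke
    obtain ⟨m, hm, rfl⟩ := Finset.mem_image.1 hk
    rw [← (Finset.mem_filter.1 hm).2]
    simpa [ex, deg] using hp m (Finset.mem_filter.1 hm).1 e hke
  · rw [Finset.sum_image hinj, Finset.sum_filter]
    have := congrArg (coeff (Finsupp.equivFunOnFinite.symm (deg m₀))) h0
    rw [p.as_sum, map_sum, coeff_sum, coeff_zero] at this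
    refine Eq.trans (Finset.sum_congr rfl fun m _ => ?_) this
    rw [eulerHom_monomial, coeff_monomial]
    by_cases hm : deg m = deg m₀
    · rw [if_pos hm, if_pos (congrArg _ hm), hjoin m hm]
    · rw [if_neg hm, if_neg fun h => hm (Finsupp.equivFunOnFinite.symm.injective h)]
  · exact Finset.mem_image_of_mem _ (by simp [G, hm₀])

theorem X_mul_prod_X_eq_monomial {σ : Type*} (a : Chi r → σ) (e : σ) (S : Finset (Chi r)) :
    (X e * ∏ f ∈ S, X (a f) : MvPolynomial σ (ZMod 2)) =
      monomial (Finsupp.single e 1 + ∑ f ∈ S, Finsupp.single (a f) 1) 1 := by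
  rw [← mul_one (1 : ZMod 2), ← monomial_mul, monomial_sum_one]
  rfl

theorem monomial_mem_relIdeal_sup (idx : Chi r → ℕ) (m : Chi r ⊕ Chi r →₀ ℕ) :
    monomial m 1 ∈ (relIdeal r).restrictScalars (ZMod 2) ⊔
      restrictSupport (ZMod 2) {m | IsStandard idx m} := by
  classical
  let wt : (Chi r ⊕ Chi r →₀ ℕ) →ₗ[ℕ] ℕ :=
    Finsupp.linearCombination ℕ (Sum.elim idx fun _ => 0)
  induction hN : wt m using Nat.strong_induction_on generalizing m with
  | _ N ih =>
  by_cases hm : IsStandard idx m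
  · refine Submodule.mem_sup_right ?_
    rw [mem_restrictSupport_iff]
    intro m' hm'
    rwa [Finset.mem_singleton.1 (support_monomial_subset hm')]
  · unfold IsStandard at hm
    push Not at hm
    obtain ⟨e, he, hspan⟩ := hm
    obtain ⟨S, hSA, heS, hT⟩ := exists_minDep_of_mem_span (by simp) hspan
    obtain ⟨m', hm'⟩ : ∃ m', m = m' + (Finsupp.single (Sum.inl e) 1 +
        ∑ f ∈ S, Finsupp.single (Sum.inr f) 1) := by
      suffices h : Finsupp.single (Sum.inl e) 1 + ∑ f ∈ S, Finsupp.single (Sum.inr f) 1 ≤ m from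
        ⟨_, (tsub_add_cancel_of_le h).symm⟩
      rintro (f | f)
      · rcases eq_or_ne e f with rfl | hf
        · simpa [Finsupp.finsetSum_apply] using Nat.succ_le_of_lt he
        · simp [hf]
      · by_cases hf : f ∈ S
        · simpa [Finsupp.finsetSum_apply, Finsupp.single_apply, hf] using
            Nat.succ_le_of_lt (hSA hf).2
        · simp [Finsupp.single_apply, hf]
    have hr : monomial m (1 : ZMod 2) = monomial m' 1 * rpoly (insert e S) -
        ∑ f ∈ S, monomial (m' + (Finsupp.single (Sum.inl f) 1 +
          ∑ g ∈ (insert e S).erase f, Finsupp.single (Sum.inr g) 1)) 1 := by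
      rw [rpoly, Finset.sum_insert heS, Finset.erase_insert heS]
      simp only [X_mul_prod_X_eq_monomial]
      rw [mul_add, Finset.mul_sum]
      simp only [monomial_mul, mul_one]
      rw [add_sub_cancel_right, hm']
    rw [hr]
    refine Submodule.sub_mem _ (Submodule.mem_sup_left ?_) (Submodule.sum_mem _ fun f hf => ?_)
    · exact Ideal.mul_mem_left _ _ (Ideal.subset_span ⟨_, hT, rfl⟩)
    · refine ih _ ?_ _ rfl
      have := (hSA hf).1
      rw [← hN, hm']
      simpa [wt, map_add, map_sum, Finsupp.linearCombination_single] using this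

theorem ker_eulerHom (r : ℕ) : RingHom.ker (eulerHom r) = relIdeal r := by
  refine le_antisymm (fun p hp => ?_) relIdeal_le_ker_eulerHom
  obtain ⟨n, ⟨φ⟩⟩ := Finite.exists_equiv_fin (Chi r)
  let idx : Chi r → ℕ := fun e => φ e
  have hidx : Function.Injective idx := Fin.val_injective.comp φ.injective
  have hmem : p ∈ (relIdeal r).restrictScalars (ZMod 2) ⊔
      restrictSupport (ZMod 2) {m | IsStandard idx m} := by
    rw [p.as_sum]
    refine Submodule.sum_mem _ fun m _ => ?_
    rw [← mul_one (coeff m p), ← smul_eq_mul, ← smul_monomial]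
    exact Submodule.smul_mem _ _ (monomial_mem_relIdeal_sup idx m)
  obtain ⟨a, ha, b, hb, rfl⟩ := Submodule.mem_sup.1 hmem
  have ha' : eulerHom r a = 0 := relIdeal_le_ker_eulerHom ha
  have hb' : eulerHom r b = 0 := by
    have : eulerHom r (a + b) = 0 := hp
    rwa [map_add, ha', zero_add] at this
  rw [eq_zero_of_isStandard_of_eulerHom_eq_zero hidx
    (fun m hm => (mem_restrictSupport_iff _).1 hb hm) hb', add_zero]
  exact ha

end Relations

/-- The representation-graded Bredon homology ring `H(A,★) = P/I` is a domain. -/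
theorem stmt0 (r : ℕ) :
    IsDomain (MvPolynomial (Chi r ⊕ Chi r) (ZMod 2) ⧸ relIdeal r) := by
  rw [Ideal.Quotient.isDomain_iff_prime, ← ker_eulerHom]
  exact RingHom.ker_isPrime _
end

section
/- For every minimally dependent finite subset T₀ ⊆ χ, the polynomial r(T₀) does not belong to the ideal of P generated by the set {r(T) : T ⊆ χ minimally dependent, T ≠ T₀}. (This is the minimality of the paper's presentation: every set of homogeneous generators of the relation ideal must contain all the polynomials r(T) for minimally dependent T.) -/
open MvPolynomial

/-- Evaluating `rpoly T` at `a = indicator of l`, `t = indicator of S` gives `1` exactly when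
`l ∈ T` and `T` without `l` lies in `S`. -/
lemma eval_rpoly_indicator {r : ℕ} (T S : Finset (Chi r)) (l : Chi r) :
    eval (Sum.elim (fun x => if x = l then 1 else 0) (fun x => if x ∈ S then 1 else 0))
      (rpoly T) = if l ∈ T ∧ T.erase l ⊆ S then (1 : ZMod 2) else 0 := by
  simp only [rpoly, map_sum, map_mul, map_prod, eval_X, Sum.elim_inl, Sum.elim_inr, ite_mul,
    one_mul, zero_mul, Finset.sum_ite_eq', Finset.prod_ite_zero, Finset.prod_const_one, ite_and,
    Finset.subset_iff]

/-- Distinct minimally dependent sets are not contained in one another. -/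
lemma MinDep.eq_of_subset {r : ℕ} {S T : Finset (Chi r)} (hS : MinDep S) (hT : MinDep T)
    (h : S ⊆ T) : S = T := by
  by_contra hne
  exact hS.1 (hT.2 S (h.ssubset_of_ne hne))

lemma MinDep.nonempty {r : ℕ} {T : Finset (Chi r)} (hT : MinDep T) : T.Nonempty := by
  by_contra h
  obtain rfl := Finset.not_nonempty_iff_eq_empty.mp h
  have : IsEmpty ((∅ : Finset (Chi r)) : Set (Chi r)) := by simp
  exact hT.1 linearIndependent_empty_type

/-- Minimality of the presentation: for any minimally dependent set `T₀`, the relation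
`r(T₀)` is not in the ideal generated by the relations of all other minimally
dependent sets. -/
theorem stmt1 (r : ℕ) (T₀ : Finset (Chi r)) (hT₀ : MinDep T₀) :
    rpoly T₀ ∉
      Ideal.span {p : MvPolynomial (Chi r ⊕ Chi r) (ZMod 2) |
        ∃ T : Finset (Chi r), MinDep T ∧ T ≠ T₀ ∧ p = rpoly T} := by
  intro hmem
  obtain ⟨l, hl⟩ := hT₀.nonempty
  let φ : MvPolynomial (Chi r ⊕ Chi r) (ZMod 2) →+* ZMod 2 :=
    eval (Sum.elim (fun x => if x = l then 1 else 0) (fun x => if x ∈ T₀ then 1 else 0))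
  have hker : rpoly T₀ ∈ RingHom.ker φ := by
    refine Ideal.span_le.mpr ?_ hmem
    rintro _ ⟨T, hT, hne, rfl⟩
    refine (eval_rpoly_indicator T T₀ l).trans (if_neg ?_)
    rintro ⟨-, hsub⟩
    refine hne (hT.eq_of_subset hT₀ fun x hx => ?_)
    by_cases hxl : x = l
    · exact hxl ▸ hl
    · exact hsub (Finset.mem_erase.mpr ⟨hxl, hx⟩)
  have hone : φ (rpoly T₀) = 1 :=
    (eval_rpoly_indicator T₀ T₀ l).trans (if_pos ⟨hl, Finset.erase_subset l T₀⟩)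
  exact one_ne_zero (hone.symm.trans hker)
end

section
/- For every finite subset T ⊆ χ whose elements sum to zero in W (i.e., ∑_{λ∈T} λ = 0), the polynomial r(T) = ∑_{λ∈T} a_λ · ∏_{μ∈T\{λ}} t_μ belongs to the ideal I generated by the polynomials r(S) for all minimally dependent finite subsets S of χ. (In the paper this reflects that the orientability relation of Proposition 1.5(ii) holds for every set of characters with trivial product, and that all such relations are generated by those for minimally dependent sets.) -/
open MvPolynomial

/-- Over `F₂`, a finite set of vectors is linearly independent unless some nonempty subset
sums to zero. -/
theorem linearIndepOn_zmod_two_of_forall_sum_ne_zero {ι M : Type*} [AddCommGroup M]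
    [Module (ZMod 2) M] {v : ι → M} {S : Finset ι}
    (h : ∀ U ⊆ S, U.Nonempty → ∑ i ∈ U, v i ≠ 0) :
    LinearIndepOn (ZMod 2) v (S : Set ι) := by
  classical
  rw [linearIndepOn_finset_iff]
  intro g hg
  by_contra! hne
  obtain ⟨i, hi, hgi⟩ := hne
  refine h (S.filter fun j => g j ≠ 0) (Finset.filter_subset _ _)
    ⟨i, Finset.mem_filter.2 ⟨hi, hgi⟩⟩ ?_
  rw [← hg, Finset.sum_filter]
  refine Finset.sum_congr rfl fun j _ => ?_
  have h01 : ∀ a : ZMod 2, a = 0 ∨ a = 1 := by decide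
  rcases h01 (g j) with h0 | h1
  · simp [h0]
  · simp [h1]

/-- A nonempty finite set of vectors with zero sum is linearly dependent. -/
theorem not_linearIndepOn_of_sum_eq_zero {ι R M : Type*} [Ring R] [Nontrivial R]
    [AddCommGroup M] [Module R M] {v : ι → M} {S : Finset ι} (hS : S.Nonempty)
    (h : ∑ i ∈ S, v i = 0) : ¬ LinearIndepOn R v (S : Set ι) := by
  rw [linearIndepOn_finset_iff]
  intro hli
  obtain ⟨i, hi⟩ := hS
  exact one_ne_zero (hli (fun _ => 1) (by simpa using h) i hi)

/-- The Leibniz rule for `rpoly` on a disjoint union. -/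
theorem rpoly_union {r : ℕ} {S U : Finset (Chi r)} (h : Disjoint S U) :
    rpoly (S ∪ U) = rpoly S * ∏ mu ∈ U, X (Sum.inr mu) + rpoly U * ∏ mu ∈ S, X (Sum.inr mu) := by
  unfold rpoly
  rw [Finset.sum_union h, Finset.sum_mul, Finset.sum_mul]
  congr 1
  · refine Finset.sum_congr rfl fun x hx => ?_
    have hxU : x ∉ U := Finset.disjoint_left.1 h hx
    rw [Finset.erase_union_distrib, Finset.erase_eq_of_notMem hxU,
      Finset.prod_union (h.mono_left (Finset.erase_subset _ _)), mul_assoc]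
  · refine Finset.sum_congr rfl fun x hx => ?_
    have hxS : x ∉ S := Finset.disjoint_right.1 h hx
    rw [Finset.erase_union_distrib, Finset.erase_eq_of_notMem hxS,
      Finset.prod_union (h.mono_right (Finset.erase_subset _ _)), mul_assoc,
      mul_comm (∏ mu ∈ S, _)]

/-- For every finite set `T` of nonzero vectors summing to zero, the relation
polynomial `r(T)` lies in the ideal generated by the relations of the minimally
dependent sets. -/
theorem stmt2 (r : ℕ) (T : Finset (Chi r)) (h : ∑ lam ∈ T, lam.val = 0) :
    rpoly T ∈ relIdeal r := by
  induction T using Finset.strongInduction with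
  | H T ih =>
    rcases T.eq_empty_or_nonempty with rfl | hT
    · simp [rpoly]
    by_cases hmin : ∃ U, U ⊂ T ∧ U.Nonempty ∧ ∑ lam ∈ U, lam.val = 0
    · obtain ⟨U, hUT, hU, hsum⟩ := hmin
      have hsum' : ∑ lam ∈ T \ U, lam.val = 0 := by
        have hsplit := Finset.sum_sdiff (f := fun lam : Chi r => lam.val) hUT.subset
        rwa [hsum, h, add_zero] at hsplit
      rw [← Finset.union_sdiff_of_subset hUT.subset, rpoly_union Finset.disjoint_sdiff]
      exact Ideal.add_mem _ (Ideal.mul_mem_right _ _ (ih U hUT hsum))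
        (Ideal.mul_mem_right _ _ (ih _ (Finset.sdiff_ssubset hUT.subset hU) hsum'))
    · refine Ideal.subset_span ⟨T, ⟨not_linearIndepOn_of_sum_eq_zero hT h, fun S hST => ?_⟩, rfl⟩
      exact linearIndepOn_zmod_two_of_forall_sum_ne_zero (v := fun lam : Chi r => lam.val)
        fun U hUS hU hsum => hmin ⟨U, hUS.trans_ssubset hST, hU, hsum⟩
end

section
/- For every natural number k ≥ 2, the number of minimally dependent subsets of χ with exactly k+1 elements, multiplied by (k+1)!, equals ∏_{i=1}^{k} (2^r − 2^{i−1}). Equivalently, there are exactly (2^r−1)(2^r−2)⋯(2^r−2^{k−1})/(k+1)! minimally dependent subsets of χ with k+1 elements. -/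
open MvPolynomial

/-- Over `F₂`, linear independence means that no nonempty subfamily sums to zero. -/
theorem linearIndependent_zmod_two_iff {ι V : Type*} [AddCommGroup V] [Module (ZMod 2) V]
    {v : ι → V} :
    LinearIndependent (ZMod 2) v ↔ ∀ s : Finset ι, ∑ i ∈ s, v i = 0 → s = ∅ := by
  classical
  rw [linearIndependent_iff']
  constructor
  · intro h s hs
    refine Finset.eq_empty_of_forall_notMem fun i hi => ?_
    exact one_ne_zero (h s (fun _ => 1) (by simpa using hs) i hi)
  · intro h s g hg i hi
    have hfilter : s.filter (fun j => g j ≠ 0) = ∅ := by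
      apply h
      rw [Finset.sum_filter]
      refine (Finset.sum_congr rfl fun j _ => ?_).trans hg
      rcases Fin.exists_fin_two.mp ⟨g j, rfl⟩ with hj | hj
      · have hj' : g j = 0 := hj
        simp [hj']
      · have hj' : g j = 1 := hj
        simp [hj']
    by_contra hne
    exact Finset.notMem_empty i (hfilter ▸ Finset.mem_filter.mpr ⟨hi, hne⟩)

/-- A finite family of vectors over `F₂` whose only subfamilies summing to zero are the empty one
and the whole family. -/
def IsZeroSumCircuit {ι V : Type*} [Fintype ι] [AddCommGroup V] (w : ι → V) : Prop :=
  ∑ i, w i = 0 ∧ ∀ s : Finset ι, s ≠ Finset.univ → ∑ i ∈ s, w i = 0 → s = ∅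

theorem isZeroSumCircuit_iff_init {V : Type*} [AddCommGroup V] [Module (ZMod 2) V] {k : ℕ}
    (w : Fin (k + 1) → V) :
    IsZeroSumCircuit w ↔
      ∑ i, w i = 0 ∧ LinearIndependent (ZMod 2) (fun i : Fin k => w i.castSucc) := by
  rw [IsZeroSumCircuit, linearIndependent_zmod_two_iff]
  refine and_congr_right fun hw => ⟨fun h s hs => ?_, fun h => ?_⟩
  · have hmap : s.map Fin.castSuccEmb = ∅ := by
      apply h
      · intro hu
        have := hu ▸ Finset.mem_univ (Fin.last k)
        simp at this
      · simpa using hs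
    simpa using hmap
  · have key : ∀ s : Finset (Fin (k + 1)), Fin.last k ∉ s → ∑ i ∈ s, w i = 0 → s = ∅ := by
      intro s hl hs
      have hmap : (Finset.univ.filter fun i : Fin k => i.castSucc ∈ s).map Fin.castSuccEmb = s := by
        ext i
        refine Fin.lastCases ?_ (fun j => ?_) i
        · simp [hl]
        · simp
      rw [← hmap, Finset.sum_map] at hs
      rw [← hmap, h _ hs, Finset.map_empty]
    intro s hne hs
    by_cases hl : Fin.last k ∈ s
    · refine absurd ?_ hne
      rw [← Finset.compl_eq_empty_iff]
      refine key sᶜ (by simpa using hl) ?_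
      rw [← Finset.sum_add_sum_compl s, hs, zero_add] at hw
      exact hw
    · exact key s hl hs

theorem IsZeroSumCircuit.ne_zero {ι V : Type*} [Fintype ι] [AddCommGroup V] {w : ι → V}
    (hw : IsZeroSumCircuit w) (hι : 2 ≤ Fintype.card ι) (i : ι) : w i ≠ 0 := by
  intro hi
  have hne : ({i} : Finset ι) ≠ Finset.univ := by
    intro h
    have := congrArg Finset.card h
    rw [Finset.card_singleton, Finset.card_univ] at this
    omega
  simpa using hw.2 {i} hne (by simpa using hi)

theorem IsZeroSumCircuit.injective {ι V : Type*} [Fintype ι] [AddCommGroup V] [Module (ZMod 2) V]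
    {w : ι → V} (hw : IsZeroSumCircuit w) (hι : 3 ≤ Fintype.card ι) : Function.Injective w := by
  classical
  intro i j hij
  by_contra hne
  have hpair : ({i, j} : Finset ι) ≠ Finset.univ := by
    intro h
    have := congrArg Finset.card h
    rw [Finset.card_pair hne, Finset.card_univ] at this
    omega
  have hsum : ∑ l ∈ ({i, j} : Finset ι), w l = 0 := by
    rw [Finset.sum_pair hne, hij, ZModModule.add_self]
  simpa using hw.2 _ hpair hsum

theorem linearIndependent_map_iff {r : ℕ} {ι : Type*} (e : ι ↪ Chi r) (s : Finset ι) :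
    LinearIndependent (ZMod 2) (fun x : (s.map e : Set (Chi r)) => (x : Chi r).val) ↔
      ∀ t ⊆ s, ∑ i ∈ t, (e i).val = 0 → t = ∅ := by
  classical
  rw [linearIndependent_zmod_two_iff]
  constructor
  · intro h t hts ht
    have h0 := h (t.attach.map ⟨fun i => ⟨e i.1, by
      simpa using hts i.2⟩, fun a b hab => Subtype.ext (e.injective (congrArg Subtype.val hab))⟩) (by
        rw [Finset.sum_map]
        exact (Finset.sum_attach t fun i => (e i).val).trans ht)
    simpa using h0
  · intro h t ht
    have hsub : t.map (Function.Embedding.subtype _) ⊆ s.map e := by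
      intro x hx
      obtain ⟨y, -, rfl⟩ := Finset.mem_map.mp hx
      exact y.2
    obtain ⟨u, hus, hu⟩ := Finset.subset_map_iff.mp hsub
    have h0 : u = ∅ := by
      apply h u hus
      have := congrArg (fun z : Finset (Chi r) => ∑ x ∈ z, x.val) hu
      simp only [Finset.sum_map] at this
      exact this.symm.trans ht
    simpa [h0] using hu

theorem minDep_map_univ_iff {r : ℕ} {ι : Type*} [Fintype ι] [Nonempty ι] (e : ι ↪ Chi r) :
    MinDep (Finset.univ.map e) ↔ IsZeroSumCircuit fun i => (e i).val := by
  rw [MinDep, linearIndependent_map_iff, IsZeroSumCircuit]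
  constructor
  · rintro ⟨hdep, hind⟩
    have hproper : ∀ s : Finset ι, s ≠ Finset.univ → ∑ i ∈ s, (e i).val = 0 → s = ∅ := by
      intro s hs
      exact (linearIndependent_map_iff e s).mp
        (hind _ (Finset.map_ssubset_map.mpr (Finset.ssubset_univ_iff.mpr hs))) s subset_rfl
    refine ⟨?_, hproper⟩
    push Not at hdep
    obtain ⟨t, -, ht, hne⟩ := hdep
    by_cases htu : t = Finset.univ
    · rwa [htu] at ht
    · exact absurd (hproper t htu ht) hne.ne_empty
  · rintro ⟨hsum, hproper⟩
    refine ⟨fun h => Finset.univ_nonempty.ne_empty (h _ subset_rfl hsum), fun S hS => ?_⟩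
    obtain ⟨u, -, rfl⟩ := Finset.subset_map_iff.mp hS.subset
    rw [linearIndependent_map_iff]
    intro t htu
    exact hproper t (Finset.ssubset_univ_iff.mp
      (lt_of_le_of_lt htu (Finset.map_ssubset_map.mp hS)))

/-- Each `n`-element set is the image of exactly `n!` embeddings of `Fin n`. -/
theorem ncard_mul_factorial_eq_card_embedding {α : Type*} [Finite α] (n : ℕ)
    (p : Finset α → Prop) :
    Set.ncard {T : Finset α | p T ∧ T.card = n} * n.factorial =
      Nat.card {e : Fin n ↪ α // p (Finset.univ.map e)} := by
  classical
  have := Fintype.ofFinite α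
  let f : (Σ T : {T : Finset α // p T ∧ T.card = n}, Fin n ≃ T.1) →
      {e : Fin n ↪ α // p (Finset.univ.map e)} := fun x =>
    ⟨x.2.toEmbedding.trans (Function.Embedding.subtype _), by
      rw [← Finset.map_map, Finset.map_univ_equiv, Finset.univ_eq_attach,
        Finset.attach_map_val]
      exact x.1.2.1⟩
  have hf : Function.Bijective f := by
    constructor
    · rintro ⟨⟨T, hT⟩, a⟩ ⟨⟨T', hT'⟩, b⟩ hab
      have hval : ∀ i, (a i : α) = b i := fun i =>
        DFunLike.congr_fun (congrArg Subtype.val hab) i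
      obtain rfl : T = T' := by
        ext x
        constructor
        · intro hx
          have := hval (a.symm ⟨x, hx⟩)
          simp only [Equiv.apply_symm_apply] at this
          exact this ▸ (b _).2
        · intro hx
          have := hval (b.symm ⟨x, hx⟩)
          simp only [Equiv.apply_symm_apply] at this
          exact this ▸ (a _).2
      congr 1
      ext i
      exact hval i
    · rintro ⟨e, he⟩
      refine ⟨⟨⟨Finset.univ.map e, he, by simp⟩, Equiv.ofBijective
        (fun i => ⟨e i, by simp⟩) ⟨fun i j hij => e.injective (congrArg Subtype.val hij), ?_⟩⟩, ?_⟩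
      · rintro ⟨x, hx⟩
        obtain ⟨i, -, rfl⟩ := Finset.mem_map.mp hx
        exact ⟨i, rfl⟩
      · rfl
  rw [← Nat.card_congr (Equiv.ofBijective f hf), Nat.card_sigma]
  have hcard : ∀ T : {T : Finset α // p T ∧ T.card = n}, Nat.card (Fin n ≃ T.1) = n.factorial := by
    intro T
    rw [Nat.card_eq_fintype_card, Fintype.card_equiv (Fintype.equivOfCardEq (by simp [T.2.2])),
      Fintype.card_fin]
  simp only [hcard, Finset.sum_const, smul_eq_mul, Finset.card_univ]
  rw [← Nat.card_eq_fintype_card]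
  rfl

/-- Deleting the last vector of a zero-sum circuit of length `k + 1` gives a bijection onto the
linearly independent families of length `k`. -/
theorem card_isZeroSumCircuit_embedding (r k : ℕ) (hk : 2 ≤ k) :
    Nat.card {e : Fin (k + 1) ↪ Chi r // IsZeroSumCircuit fun i => (e i).val} =
      Nat.card {v : Fin k → W r // LinearIndependent (ZMod 2) v} := by
  refine Nat.card_congr (Equiv.ofBijective
    (fun e => ⟨fun i => (e.1 i.castSucc).val, ((isZeroSumCircuit_iff_init _).mp e.2).2⟩) ⟨?_, ?_⟩)
  · rintro ⟨e, he⟩ ⟨e', he'⟩ h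
    have hinit : ∀ i : Fin k, (e i.castSucc).val = (e' i.castSucc).val :=
      congrFun (congrArg Subtype.val h)
    have hsum := he.1.trans he'.1.symm
    simp only [Fin.sum_univ_castSucc, hinit, add_right_inj] at hsum
    refine Subtype.ext (DFunLike.ext _ _ fun i => Subtype.ext ?_)
    exact Fin.lastCases hsum hinit i
  · rintro ⟨v, hv⟩
    have hw : IsZeroSumCircuit (Fin.snoc v (∑ i, v i) : Fin (k + 1) → W r) := by
      rw [isZeroSumCircuit_iff_init]
      refine ⟨?_, by simpa using hv⟩
      simp only [Fin.sum_univ_castSucc, Fin.snoc_castSucc, Fin.snoc_last]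
      exact ZModModule.add_self _
    refine ⟨⟨⟨fun i => ⟨_, hw.ne_zero (by rw [Fintype.card_fin]; omega) i⟩, fun i j hij =>
      hw.injective (by rw [Fintype.card_fin]; omega) (congrArg Subtype.val hij)⟩, hw⟩, ?_⟩
    ext1
    funext i
    exact Fin.snoc_castSucc (α := fun _ => W r) _ _ i

theorem card_linearIndependent_W (r k : ℕ) :
    Nat.card {v : Fin k → W r // LinearIndependent (ZMod 2) v} =
      ∏ i ∈ Finset.range k, (2 ^ r - 2 ^ i) := by
  by_cases hkr : k ≤ r
  · have h := card_linearIndependent (K := ZMod 2) (V := W r) (k := k) (by simpa using hkr)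
    rw [← Fin.prod_univ_eq_prod_range (fun i => 2 ^ r - 2 ^ i)]
    simpa using h
  · push Not at hkr
    rw [Finset.prod_eq_zero (Finset.mem_range.mpr hkr) (Nat.sub_self (2 ^ r))]
    have : IsEmpty {v : Fin k → W r // LinearIndependent (ZMod 2) v} :=
      ⟨fun v => by
        have := v.2.fintype_card_le_finrank
        simp only [Fintype.card_fin, Module.finrank_fin_fun] at this
        omega⟩
    exact Nat.card_of_isEmpty

/-- The number of minimally dependent subsets of the nonzero vectors of `F₂^r` with
exactly `k+1` elements, multiplied by `(k+1)!`, equals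
`(2^r - 1)(2^r - 2)⋯(2^r - 2^(k-1))`. -/
theorem stmt5 (r k : ℕ) (hk : 2 ≤ k) :
    Set.ncard {T : Finset (Chi r) | MinDep T ∧ T.card = k + 1} * Nat.factorial (k + 1) =
      ∏ i ∈ Finset.range k, (2 ^ r - 2 ^ i) := by
  rw [ncard_mul_factorial_eq_card_embedding, ← card_linearIndependent_W,
    ← card_isZeroSumCircuit_embedding r k hk]
  simp only [minDep_map_univ_iff]
end

section
/- Let S ⊆ ι be a finite subset and let α, β, γ be three pairwise distinct elements of ι, none of which belongs to S. Then the identity t_γ · r(S ∪ {α,β}) = t_α · t_β · r(S ∪ {γ}) + r({α,β,γ}) · ∏_{λ∈S} t_λ holds in the polynomial ring P over F₂. (This identity is used in the paper to show that the localized relations for minimally dependent sets of four or more characters are redundant.) -/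
open MvPolynomial

/-- The relation polynomial `r(T) = ∑_{λ∈T} a_λ ∏_{μ∈T\{λ}} t_μ` in
`P = F₂[a_i, t_i : i ∈ ι]`, with `a_i = X (Sum.inl i)` and `t_i = X (Sum.inr i)`. -/
noncomputable def rp {ι : Type*} [DecidableEq ι] (T : Finset ι) :
    MvPolynomial (ι ⊕ ι) (ZMod 2) :=
  ∑ lam ∈ T, X (Sum.inl lam) * ∏ mu ∈ T.erase lam, X (Sum.inr mu)

/-- Adjoining an element `x ∉ T` multiplies `r(T)` by `t_x` and adds `a_x ∏_{μ∈T} t_μ`. -/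
theorem rp_insert {ι : Type*} [DecidableEq ι] {T : Finset ι} {x : ι} (hx : x ∉ T) :
    rp (insert x T) =
      X (Sum.inl x) * ∏ mu ∈ T, X (Sum.inr mu) + X (Sum.inr x) * rp T := by
  unfold rp
  rw [Finset.sum_insert hx, Finset.erase_insert hx, Finset.mul_sum]
  congr 1
  refine Finset.sum_congr rfl fun y hy => ?_
  have hxy : x ≠ y := fun h => hx (h ▸ hy)
  rw [Finset.erase_insert_of_ne hxy,
    Finset.prod_insert fun h => hx (Finset.mem_of_mem_erase h)]
  ring

/-- The relation polynomial of a singleton is `a_x`. -/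
theorem rp_singleton {ι : Type*} [DecidableEq ι] (x : ι) : rp {x} = X (Sum.inl x) := by
  simp [rp]

/-- The identity `t_γ · r(S ∪ {α,β}) = t_α t_β · r(S ∪ {γ}) + r({α,β,γ}) · ∏_{λ∈S} t_λ`
for pairwise distinct `α, β, γ` not belonging to `S`. -/
theorem stmt10 {ι : Type*} [DecidableEq ι] (S : Finset ι) (α β γ : ι)
    (hαβ : α ≠ β) (hαγ : α ≠ γ) (hβγ : β ≠ γ)
    (hα : α ∉ S) (hβ : β ∉ S) (hγ : γ ∉ S) :
    X (Sum.inr γ) * rp (S ∪ {α, β}) =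
      X (Sum.inr α) * X (Sum.inr β) * rp (S ∪ {γ}) +
        rp {α, β, γ} * ∏ lam ∈ S, X (Sum.inr lam) := by
  have hαβS : S ∪ {α, β} = insert α (insert β S) := by simp
  have hγS : S ∪ {γ} = insert γ S := by simp
  rw [hαβS, hγS, rp_insert (by simp [hαβ, hα] : α ∉ insert β S), rp_insert hβ, rp_insert hγ,
    rp_insert (by simp [hαβ, hαγ] : α ∉ ({β, γ} : Finset ι)),
    rp_insert (by simpa using hβγ : β ∉ ({γ} : Finset ι)), rp_singleton,
    Finset.prod_insert hβ, Finset.prod_pair hβγ, Finset.prod_singleton]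
  linear_combination -(X (Sum.inr α) * X (Sum.inr β) * X (Sum.inl γ) *
    ∏ lam ∈ S, X (Sum.inr lam)) * CharTwo.two_eq_zero (R := MvPolynomial (ι ⊕ ι) (ZMod 2))
end

section
/- For every minimally dependent finite subset T ⊆ χ with |T| ≥ 4, the polynomial r̄(T) lies in the ideal of Q generated by the polynomials r̄(T') for all minimally dependent subsets T' ⊆ χ with exactly 3 elements. (This is the key step in the paper's Theorem on the localized twisted cohomology ring H(A|B): in the localization, all relations coming from minimally dependent sets of four or more characters become redundant.) -/
open MvPolynomial

/-- `χ₊ = W \ U`: the characters restricting nontrivially to the subgroup. -/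
abbrev ChiP {r : ℕ} (U : Submodule (ZMod 2) (W r)) : Type := {w : W r // w ∉ U}

/-- `χ₋ = U \ {0}`: the nontrivial characters restricting trivially to the subgroup. -/
abbrev ChiM {r : ℕ} (U : Submodule (ZMod 2) (W r)) : Type := {w : W r // w ∈ U ∧ w ≠ 0}

open Classical in
/-- the part `T ∩ χ₊` of a finite set `T` of nonzero vectors. -/
noncomputable def Tplus {r : ℕ} (U : Submodule (ZMod 2) (W r)) (T : Finset (Chi r)) :
    Finset (ChiP U) :=
  (T.image Subtype.val).subtype (fun w => w ∉ U)

open Classical in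
/-- the part `T ∩ χ₋` of a finite set `T` of nonzero vectors. -/
noncomputable def Tminus {r : ℕ} (U : Submodule (ZMod 2) (W r)) (T : Finset (Chi r)) :
    Finset (ChiM U) :=
  (T.image Subtype.val).subtype (fun w => w ∈ U ∧ w ≠ 0)

/-- The localized relation polynomial
`r̄(T) = ∑_{λ∈T∩χ₊} ∏_{μ∈(T∩χ₊)\{λ}} x_μ + (∑_{λ∈T∩χ₋} e_λ) ∏_{μ∈T∩χ₊} x_μ`
in `Q = F₂[x_λ (λ ∈ χ₊), e_μ (μ ∈ χ₋)]`, where `x_λ = X (Sum.inl λ)` and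
`e_μ = X (Sum.inr μ)`. -/
noncomputable def rbar {r : ℕ} (U : Submodule (ZMod 2) (W r)) (T : Finset (Chi r)) :
    MvPolynomial (ChiP U ⊕ ChiM U) (ZMod 2) :=
  (∑ lam ∈ Tplus U T, ∏ mu ∈ (Tplus U T).erase lam, X (Sum.inl mu)) +
    (∑ lam ∈ Tminus U T, X (Sum.inr lam)) * ∏ mu ∈ Tplus U T, X (Sum.inl mu)

/-- Over `ZMod 2`, a finite family of vectors is linearly independent iff no nonempty
subfamily sums to zero. -/
theorem linearIndependent_zmod_two_iff_s12 {r : ℕ} (T : Finset (Chi r)) :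
    LinearIndependent (ZMod 2) (fun x : (T : Set (Chi r)) => (x : Chi r).val) ↔
      ∀ S ⊆ T, ∑ x ∈ S, x.val = 0 → S = ∅ := by
  classical
  change LinearIndepOn (ZMod 2) (fun x : Chi r => x.val) (T : Set (Chi r)) ↔ _
  rw [linearIndepOn_finset_iff]
  constructor
  · intro h S hS hsum
    have key := h (fun x => if x ∈ S then 1 else 0) (by
      simpa [ite_smul, Finset.sum_ite_mem, Finset.inter_eq_right.2 hS] using hsum)
    refine Finset.eq_empty_of_forall_notMem fun x hx => ?_
    simpa [hx] using key x (hS hx)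
  · intro h f hf i hi
    have hS := h (T.filter fun x => f x ≠ 0) (Finset.filter_subset _ _) (by
      rw [Finset.sum_filter]
      refine Eq.trans ?_ hf
      refine Finset.sum_congr rfl fun x _ => ?_
      have h01 : ∀ c : ZMod 2, c = 0 ∨ c = 1 := by decide
      rcases h01 (f x) with h0 | h1
      · simp [h0]
      · simp [h1])
    by_contra hne
    exact Finset.notMem_empty i (hS ▸ Finset.mem_filter.2 ⟨hi, hne⟩)

theorem minDep_iff {r : ℕ} (T : Finset (Chi r)) :
    MinDep T ↔ T.Nonempty ∧ ∑ x ∈ T, x.val = 0 ∧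
      ∀ S ⊂ T, ∑ x ∈ S, x.val = 0 → S = ∅ := by
  simp only [MinDep, linearIndependent_zmod_two_iff_s12]
  constructor
  · rintro ⟨h1, h2⟩
    have h3 : ∀ S ⊂ T, ∑ x ∈ S, x.val = 0 → S = ∅ := fun S hS => h2 S hS S subset_rfl
    push Not at h1
    obtain ⟨S, hS, hsum, hne⟩ := h1
    rcases hS.eq_or_ssubset with rfl | hlt
    · exact ⟨hne, hsum, h3⟩
    · exact absurd (h3 S hlt hsum) hne.ne_empty
  · rintro ⟨h1, h2, h3⟩
    exact ⟨fun h => h1.ne_empty (h T subset_rfl h2),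
      fun S hS R hR => h3 R (hR.trans_ssubset hS)⟩

open Classical in
/-- Replacing one block of a bipartition of a minimally dependent set by its sum keeps
minimal dependence. -/
theorem MinDep.insert_of_union {r : ℕ} {A B : Finset (Chi r)} {p : Chi r}
    (h : MinDep (A ∪ B)) (hAB : Disjoint A B) (hA : A.Nonempty) (hpB : p ∉ B)
    (hp : ∑ x ∈ A, x.val = p.val) : MinDep (insert p B) := by
  rw [minDep_iff] at h ⊢
  obtain ⟨-, h2, h3⟩ := h
  rw [Finset.sum_union hAB, hp] at h2
  refine ⟨Finset.insert_nonempty _ _, by rwa [Finset.sum_insert hpB], fun S hS hsum => ?_⟩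
  by_cases hpS : p ∈ S
  · have hSB : S.erase p ⊂ B := by
      refine ⟨fun x hx => ?_, fun hB => hS.2 ?_⟩
      · exact Finset.mem_of_mem_insert_of_ne (hS.1 (Finset.mem_of_mem_erase hx))
          (Finset.ne_of_mem_erase hx)
      · exact Finset.insert_subset hpS (hB.trans (Finset.erase_subset _ _))
    have hd : Disjoint A (S.erase p) := hAB.mono_right hSB.1
    have hlt : A ∪ S.erase p ⊂ A ∪ B := by
      refine ⟨Finset.union_subset_union_right hSB.1, fun hsub => hSB.2 fun x hx => ?_⟩
      rcases Finset.mem_union.1 (hsub (Finset.mem_union_right _ hx)) with hxA | hxS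
      · exact absurd hx (Finset.disjoint_left.1 hAB hxA)
      · exact hxS
    have := h3 _ hlt (by rw [Finset.sum_union hd, hp, Finset.add_sum_erase S _ hpS, hsum])
    exact absurd (Finset.union_eq_empty.1 this).1 hA.ne_empty
  · have hSB : S ⊆ B := fun x hx =>
      Finset.mem_of_mem_insert_of_ne (hS.1 hx) fun e => hpS (e ▸ hx)
    refine h3 S ⟨hSB.trans Finset.subset_union_right, fun hsub => ?_⟩ hsum
    obtain ⟨a, ha⟩ := hA
    exact Finset.disjoint_left.1 hAB ha (hSB (hsub (Finset.mem_union_left _ ha)))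

section Relation

variable {r : ℕ} (U : Submodule (ZMod 2) (W r))

/-- The denominator `∏_{μ ∈ T ∩ χ₊} x_μ` of the relation of `T`. -/
noncomputable def denom (T : Finset (Chi r)) : MvPolynomial (ChiP U ⊕ ChiM U) (ZMod 2) :=
  ∏ mu ∈ Tplus U T, X (Sum.inl mu)

theorem mem_Tplus {T : Finset (Chi r)} {w : ChiP U} :
    w ∈ Tplus U T ↔ ∃ h : w.val ≠ 0, (⟨w.val, h⟩ : Chi r) ∈ T := by
  simp [Tplus]

theorem mem_Tminus {T : Finset (Chi r)} {w : ChiM U} :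
    w ∈ Tminus U T ↔ (⟨w.val, w.2.2⟩ : Chi r) ∈ T := by
  simp [Tminus, w.2.2]

open Classical in
theorem Tplus_insert_of_mem {a : Chi r} (T : Finset (Chi r)) (ha : a.val ∈ U) :
    Tplus U (insert a T) = Tplus U T := by
  ext w
  have : ∀ h, (⟨w.val, h⟩ : Chi r) ≠ a := fun h e => w.2 (by rw [← e] at ha; exact ha)
  simp [mem_Tplus, this]

open Classical in
theorem Tminus_insert_of_notMem {a : Chi r} (T : Finset (Chi r)) (ha : a.val ∉ U) :
    Tminus U (insert a T) = Tminus U T := by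
  ext w
  have : (⟨w.val, w.2.2⟩ : Chi r) ≠ a := fun e => ha (by rw [← e]; exact w.2.1)
  simp [mem_Tminus, this]

open Classical in
theorem Tplus_insert_of_notMem {a : Chi r} (T : Finset (Chi r)) (ha : a.val ∉ U) :
    Tplus U (insert a T) = insert ⟨a.val, ha⟩ (Tplus U T) := by
  ext w
  simp only [mem_Tplus, Finset.mem_insert, Subtype.ext_iff]
  refine ⟨fun ⟨h, h'⟩ => h'.imp id fun h' => ⟨h, h'⟩, ?_⟩
  rintro (h | ⟨h, h'⟩)
  · exact ⟨h ▸ a.2, Or.inl h⟩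
  · exact ⟨h, Or.inr h'⟩

open Classical in
theorem Tminus_insert_of_mem {a : Chi r} (T : Finset (Chi r)) (ha : a.val ∈ U) :
    Tminus U (insert a T) = insert ⟨a.val, ha, a.2⟩ (Tminus U T) := by
  ext w
  simp [mem_Tminus, Subtype.ext_iff]

theorem sum_prod_erase_insert {ι R : Type*} [DecidableEq ι] [CommSemiring R] (f : ι → R)
    {a : ι} {s : Finset ι} (ha : a ∉ s) :
    ∑ i ∈ insert a s, ∏ j ∈ (insert a s).erase i, f j =
      ∏ j ∈ s, f j + f a * ∑ i ∈ s, ∏ j ∈ s.erase i, f j := by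
  rw [Finset.sum_insert ha, Finset.erase_insert ha, Finset.mul_sum]
  congr 1
  refine Finset.sum_congr rfl fun i hi => ?_
  have hia : a ≠ i := fun e => ha (e ▸ hi)
  rw [Finset.erase_insert_of_ne hia,
    Finset.prod_insert fun h => ha (Finset.mem_of_mem_erase h)]

open Classical in
theorem rbar_insert_of_mem {a : Chi r} {T : Finset (Chi r)} (haT : a ∉ T) (ha : a.val ∈ U) :
    rbar U (insert a T) = rbar U T + X (Sum.inr ⟨a.val, ha, a.2⟩) * denom U T := by
  rw [rbar, rbar, denom, Tplus_insert_of_mem U T ha, Tminus_insert_of_mem U T ha,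
    Finset.sum_insert fun h => haT ((mem_Tminus U).1 h)]
  ring

open Classical in
theorem rbar_insert_of_notMem {a : Chi r} {T : Finset (Chi r)} (haT : a ∉ T)
    (ha : a.val ∉ U) :
    rbar U (insert a T) = X (Sum.inl ⟨a.val, ha⟩) * rbar U T + denom U T := by
  have hn : (⟨a.val, ha⟩ : ChiP U) ∉ Tplus U T := fun h => haT ((mem_Tplus U).1 h).2
  have hsum := sum_prod_erase_insert
    (fun w : ChiP U => (X (Sum.inl w) : MvPolynomial (ChiP U ⊕ ChiM U) (ZMod 2))) hn
  rw [rbar, rbar, denom, Tplus_insert_of_notMem U T ha, Tminus_insert_of_notMem U T ha,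
    Finset.prod_insert hn]
  linear_combination hsum

open Classical in
theorem denom_insert_of_mem {a : Chi r} (T : Finset (Chi r)) (ha : a.val ∈ U) :
    denom U (insert a T) = denom U T := by
  rw [denom, denom, Tplus_insert_of_mem U T ha]

open Classical in
theorem denom_insert_of_notMem {a : Chi r} {T : Finset (Chi r)} (haT : a ∉ T)
    (ha : a.val ∉ U) :
    denom U (insert a T) = X (Sum.inl ⟨a.val, ha⟩) * denom U T := by
  rw [denom, denom, Tplus_insert_of_notMem U T ha,
    Finset.prod_insert fun h => haT ((mem_Tplus U).1 h).2]

theorem Tplus_empty : Tplus U ∅ = ∅ :=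
  Finset.eq_empty_of_forall_notMem fun w h => by simp [mem_Tplus] at h

theorem Tminus_empty : Tminus U ∅ = ∅ :=
  Finset.eq_empty_of_forall_notMem fun w h => by simp [mem_Tminus] at h

theorem rbar_empty : rbar U ∅ = 0 := by simp [rbar, Tplus_empty, Tminus_empty]

theorem denom_empty : denom U ∅ = 1 := by simp [denom, Tplus_empty]

open Classical in
theorem denom_union {A B : Finset (Chi r)} (hAB : Disjoint A B) :
    denom U (A ∪ B) = denom U A * denom U B := by
  induction A using Finset.induction_on with
  | empty => simp [denom_empty]
  | insert a A ha ih =>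
    obtain ⟨haB, hAB⟩ := Finset.disjoint_insert_left.1 hAB
    have haAB : a ∉ A ∪ B := by simp [ha, haB]
    rw [Finset.insert_union]
    by_cases hU : a.val ∈ U
    · rw [denom_insert_of_mem U _ hU, denom_insert_of_mem U _ hU, ih hAB]
    · rw [denom_insert_of_notMem U haAB hU, denom_insert_of_notMem U ha hU, ih hAB, mul_assoc]

open Classical in
/-- The relation polynomials add up like fractions over disjoint sets. -/
theorem rbar_union {A B : Finset (Chi r)} (hAB : Disjoint A B) :
    rbar U (A ∪ B) = rbar U A * denom U B + denom U A * rbar U B := by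
  induction A using Finset.induction_on with
  | empty => simp [denom_empty, rbar_empty]
  | insert a A ha ih =>
    obtain ⟨haB, hAB⟩ := Finset.disjoint_insert_left.1 hAB
    have haAB : a ∉ A ∪ B := by simp [ha, haB]
    rw [Finset.insert_union]
    by_cases hU : a.val ∈ U
    · rw [rbar_insert_of_mem U haAB hU, rbar_insert_of_mem U ha hU,
        denom_insert_of_mem U _ hU, denom_union U hAB, ih hAB]
      ring
    · rw [rbar_insert_of_notMem U haAB hU, rbar_insert_of_notMem U ha hU,
        denom_insert_of_notMem U ha hU, denom_union U hAB, ih hAB]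
      ring

open Classical in
/-- The relation of `A ∪ B` is a combination of the relations of `A ∪ {p}` and `B ∪ {p}`. -/
theorem rbar_union_mem {A B : Finset (Chi r)} {p : Chi r} (hAB : Disjoint A B)
    (hpA : p ∉ A) (hpB : p ∉ B) {I : Ideal (MvPolynomial (ChiP U ⊕ ChiM U) (ZMod 2))}
    (hA : rbar U (insert p A) ∈ I) (hB : rbar U (insert p B) ∈ I) :
    rbar U (A ∪ B) ∈ I := by
  have h2 : (2 : MvPolynomial (ChiP U ⊕ ChiM U) (ZMod 2)) = 0 := CharTwo.two_eq_zero
  by_cases hU : p.val ∈ U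
  · have h : rbar U (A ∪ B) =
        denom U B * rbar U (insert p A) + denom U A * rbar U (insert p B) := by
      rw [rbar_union U hAB, rbar_insert_of_mem U hpA hU, rbar_insert_of_mem U hpB hU]
      linear_combination -(X (Sum.inr ⟨p.val, hU, p.2⟩) * denom U A * denom U B) * h2
    rw [h]
    exact I.add_mem (I.mul_mem_left _ hA) (I.mul_mem_left _ hB)
  · have h : rbar U (A ∪ B) =
        rbar U B * rbar U (insert p A) + rbar U A * rbar U (insert p B) := by
      rw [rbar_union U hAB, rbar_insert_of_notMem U hpA hU, rbar_insert_of_notMem U hpB hU]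
      linear_combination -(X (Sum.inl ⟨p.val, hU⟩) * rbar U A * rbar U B) * h2
    rw [h]
    exact I.add_mem (I.mul_mem_left _ hA) (I.mul_mem_left _ hB)

theorem MinDep.rbar_mem_span {T : Finset (Chi r)} (hT : MinDep T) (h3 : 3 ≤ T.card) :
    rbar U T ∈
      Ideal.span {p : MvPolynomial (ChiP U ⊕ ChiM U) (ZMod 2) |
        ∃ T' : Finset (Chi r), MinDep T' ∧ T'.card = 3 ∧ p = rbar U T'} := by
  classical
  induction hn : T.card using Nat.strong_induction_on generalizing T with
  | _ n ih =>
  subst hn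
  rcases h3.eq_or_lt with h3 | h4
  · exact Ideal.subset_span ⟨T, hT, h3.symm, rfl⟩
  obtain ⟨A, hAT, hA2⟩ := Finset.exists_subset_card_eq (show 2 ≤ T.card by lia)
  have hd : Disjoint A (T \ A) := Finset.disjoint_sdiff
  have hun : A ∪ T \ A = T := Finset.union_sdiff_of_subset hAT
  have hBcard : (T \ A).card + 2 = T.card := by
    have := Finset.card_sdiff_add_card_eq_card hAT
    lia
  obtain ⟨-, hsum, hmin⟩ := (minDep_iff T).1 hT
  have hAne : A.Nonempty := Finset.card_pos.1 (by lia)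
  have hBne : (T \ A).Nonempty := Finset.card_pos.1 (by lia)
  have hp0 : ∑ x ∈ A, x.val ≠ 0 := fun h =>
    hAne.ne_empty (hmin A ⟨hAT, fun h' => by have := Finset.card_le_card h'; lia⟩ h)
  obtain ⟨p, hp⟩ : ∃ p : Chi r, ∑ x ∈ A, x.val = p.val := ⟨⟨_, hp0⟩, rfl⟩
  have hpA : p ∉ A := fun h => by
    have he : ∑ x ∈ A.erase p, x.val = 0 := by
      rw [← Finset.add_sum_erase A _ h] at hp
      simpa using hp
    have hc := Finset.card_erase_of_mem h
    have := hmin _ ⟨(Finset.erase_subset p A).trans hAT,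
      fun h' => by have := Finset.card_le_card h'; lia⟩ he
    rw [this, Finset.card_empty] at hc
    lia
  have hpB : p ∉ T \ A := fun h => by
    have hins : ∑ x ∈ insert p A, x.val = 0 := by
      rw [Finset.sum_insert hpA, hp, ZModModule.add_self]
    have hc := Finset.card_insert_of_notMem hpA
    have := hmin _ ⟨Finset.insert_subset (Finset.mem_sdiff.1 h).1 hAT,
      fun h' => by have := Finset.card_le_card h'; lia⟩ hins
    simp at this
  have hp' : ∑ x ∈ T \ A, x.val = p.val := by
    rw [← hun, Finset.sum_union hd, hp] at hsum
    rw [eq_neg_of_add_eq_zero_right hsum, ZModModule.neg_eq_self]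
  have hcA := Finset.card_insert_of_notMem hpA
  have hcB := Finset.card_insert_of_notMem hpB
  rw [← hun] at hT ⊢
  refine rbar_union_mem U hd hpA hpB (ih _ ?_ ?_ ?_ rfl) (ih _ ?_ ?_ ?_ rfl)
  · lia
  · exact MinDep.insert_of_union (Finset.union_comm A _ ▸ hT) hd.symm hBne hpA hp'
  · lia
  · lia
  · exact hT.insert_of_union hd hAne hpB hp
  · lia

end Relation

/-- In the localization, the relation of any minimally dependent set with at least four
elements lies in the ideal generated by the relations of the three-element minimally
dependent sets. -/
theorem stmt12 (r : ℕ) (U : Submodule (ZMod 2) (W r)) (T : Finset (Chi r))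
    (hT : MinDep T) (h4 : 4 ≤ T.card) :
    rbar U T ∈
      Ideal.span {p : MvPolynomial (ChiP U ⊕ ChiM U) (ZMod 2) |
        ∃ T' : Finset (Chi r), MinDep T' ∧ T'.card = 3 ∧ p = rbar U T'} := by
  exact hT.rbar_mem_span U (by lia)
end

section
/- The quotient of Q by the ideal generated by the following three families of polynomials is an integral domain: (1) x_α·x_β + x_α·x_γ + x_β·x_γ for all α, β, γ ∈ χ₊ with α + β + γ = 0; (2) x_α + x_β + x_α·x_β·e_γ for all α, β ∈ χ₊ and γ ∈ χ₋ with α + β + γ = 0; (3) e_α + e_β + e_γ for all α, β, γ ∈ χ₋ with α + β + γ = 0. (This is the algebraic content of the paper's Theorem giving a presentation of the localized ring H(A|B) of Bredon homology, obtained by inverting the pre-Euler classes of all characters nontrivial on B and the inverse Thom classes of all other characters, together with the statement that H(A|B) is a domain.) -/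
open MvPolynomial

/-- The ideal of relations of the localized ring `H(A|B)`, in
`Q = F₂[x_λ (λ ∈ χ₊), e_μ (μ ∈ χ₋)]` where `x_λ = X (Sum.inl λ)`, `e_μ = X (Sum.inr μ)`:
it is generated by `x_α x_β + x_α x_γ + x_β x_γ` for `α, β, γ ∈ χ₊` with `α+β+γ = 0`,
by `x_α + x_β + x_α x_β e_γ` for `α, β ∈ χ₊`, `γ ∈ χ₋` with `α+β+γ = 0`, and by
`e_α + e_β + e_γ` for `α, β, γ ∈ χ₋` with `α+β+γ = 0`. -/
noncomputable def locIdeal {r : ℕ} (U : Submodule (ZMod 2) (W r)) :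
    Ideal (MvPolynomial (ChiP U ⊕ ChiM U) (ZMod 2)) :=
  Ideal.span
    ({p | ∃ α β γ : ChiP U, α.val + β.val + γ.val = 0 ∧
        p = X (Sum.inl α) * X (Sum.inl β) + X (Sum.inl α) * X (Sum.inl γ) +
            X (Sum.inl β) * X (Sum.inl γ)} ∪
     {p | ∃ α β : ChiP U, ∃ γ : ChiM U, α.val + β.val + γ.val = 0 ∧
        p = X (Sum.inl α) + X (Sum.inl β) +
            X (Sum.inl α) * X (Sum.inl β) * X (Sum.inr γ)} ∪
     {p | ∃ α β γ : ChiM U, α.val + β.val + γ.val = 0 ∧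
        p = X (Sum.inr α) + X (Sum.inr β) + X (Sum.inr γ)})

/-- Outside a subspace `V`, a vector `t` is transcendental over a subfield of the fraction field
of the symmetric algebra which contains `V`. -/
theorem exists_subfield_transcendental {F M : Type*} [Field F] [AddCommGroup M] [Module F M]
    (L : Type*) [Field L] [Algebra F L] [Algebra (SymmetricAlgebra F M) L]
    [IsScalarTower F (SymmetricAlgebra F M) L] [IsFractionRing (SymmetricAlgebra F M) L]
    (V : Submodule F M) {t : M} (ht : t ∉ V) :
    ∃ K : Subfield L,
      (∀ w ∈ V, algebraMap _ L (SymmetricAlgebra.ι F M w) ∈ K) ∧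
      Transcendental K (algebraMap _ L (SymmetricAlgebra.ι F M t)) := by
  obtain ⟨f, hft, hfV⟩ := Submodule.exists_le_ker_of_notMem ht
  let shift : SymmetricAlgebra F M →ₐ[F] Polynomial L :=
    SymmetricAlgebra.lift
      ((Algebra.linearMap L (Polynomial L)).restrictScalars F ∘ₗ
        (Algebra.linearMap (SymmetricAlgebra F M) L).restrictScalars F ∘ₗ SymmetricAlgebra.ι F M +
        f.smulRight Polynomial.X)
  have shift_ι (w : M) : shift (SymmetricAlgebra.ι F M w) =
      Polynomial.C (algebraMap _ L (SymmetricAlgebra.ι F M w)) + f w • Polynomial.X := by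
    simp [shift, Polynomial.algebraMap_eq]
  have eval_shift (s : SymmetricAlgebra F M) : (shift s).eval 0 = algebraMap _ L s := by
    have : ((Polynomial.aeval (0 : L)).restrictScalars F).comp shift =
        IsScalarTower.toAlgHom F (SymmetricAlgebra F M) L := by
      ext w
      simp [shift_ι]
    simpa [Polynomial.coe_aeval_eq_eval] using DFunLike.congr_fun this s
  have shift_inj : Function.Injective
      ((algebraMap (Polynomial L) (RatFunc L)).comp (shift : SymmetricAlgebra F M →+* _)) := by
    rw [injective_iff_map_eq_zero]
    intro s hs
    have h0 : shift s = 0 := RatFunc.algebraMap_injective L (by simpa using hs)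
    have := eval_shift s
    rw [h0, Polynomial.eval_zero] at this
    exact (IsFractionRing.injective (SymmetricAlgebra F M) L) (by simp [← this])
  let θ : L →+* RatFunc L := IsFractionRing.lift shift_inj
  have θ_ι (w : M) : θ (algebraMap _ L (SymmetricAlgebra.ι F M w)) =
      algebraMap (Polynomial L) (RatFunc L) (shift (SymmetricAlgebra.ι F M w)) := by
    simp [θ]
  refine ⟨θ.eqLocusField (algebraMap L (RatFunc L)), fun w hw => ?_, ?_⟩
  · rw [RingHom.mem_eqLocusField, θ_ι, shift_ι, show f w = 0 from hfV hw, zero_smul,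
      add_zero, ← Polynomial.algebraMap_eq, ← IsScalarTower.algebraMap_apply]
  · set τ := algebraMap _ L (SymmetricAlgebra.ι F M t)
    set K := θ.eqLocusField (algebraMap L (RatFunc L))
    rw [transcendental_iff]
    intro p hp
    have hfield : θ.comp (algebraMap K L) =
        (algebraMap (Polynomial L) (RatFunc L)).comp (Polynomial.C.comp (algebraMap K L)) := by
      ext x
      have hx : θ x = algebraMap L (RatFunc L) x := x.2
      rw [IsScalarTower.algebraMap_apply L (Polynomial L)] at hx
      exact hx
    have hcomp : (p.map (algebraMap K L)).comp (Polynomial.C τ + f t • Polynomial.X) = 0 := by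
      apply RatFunc.algebraMap_injective L
      rw [map_zero, Polynomial.comp, Polynomial.eval₂_map, Polynomial.hom_eval₂, ← hfield,
        ← shift_ι, ← θ_ι, ← Polynomial.hom_eval₂, ← Polynomial.aeval_def, hp, map_zero]
    have hdeg : (Polynomial.C τ + f t • Polynomial.X : Polynomial L).natDegree = 1 := by
      rw [add_comm, Polynomial.natDegree_add_C, ← algebraMap_smul L, Polynomial.smul_eq_C_mul,
        Polynomial.natDegree_C_mul_X]
      simpa using hft
    rcases Polynomial.comp_eq_zero_iff.1 hcomp with h | ⟨-, h⟩
    · exact (Polynomial.map_eq_zero _).1 h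
    · rw [h, Polynomial.natDegree_C] at hdeg
      exact absurd hdeg zero_ne_one

/-- Products of inverses of translates of a transcendental element, arranged along families of
pairwise disjoint sequences of poles, are linearly independent together with `1`. -/
theorem linearIndependent_prod_inv {K L ι : Type*} [Field K] [Field L] [Algebra K L] {τ : L}
    (hτ : Transcendental K τ) (a : ι → ℕ → K)
    (ha : ∀ c c' i j, c ≠ c' → a c i ≠ a c' j) :
    LinearIndependent K (fun o : Option (ι × ℕ) =>
      o.elim (1 : L) fun p => ∏ i ∈ Finset.range (p.2 + 1), (τ + algebraMap K L (a p.1 i))⁻¹) := by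
  classical
  have hne (b : K) : τ + algebraMap K L b ≠ 0 := by
    intro h
    have := transcendental_iff.1 hτ (Polynomial.X + Polynomial.C b) (by simpa using h)
    exact Polynomial.X_add_C_ne_zero b this
  -- the elements vanishing at the point `τ = -b`
  let J (b : K) : Submodule K L :=
    { carrier := {f | ∃ p q : Polynomial K, q.eval (-b) ≠ 0 ∧
        f * Polynomial.aeval τ q = (τ + algebraMap K L b) * Polynomial.aeval τ p}
      zero_mem' := ⟨0, 1, by simp, by simp⟩
      add_mem' := by
        rintro f g ⟨p, q, hq, h⟩ ⟨p', q', hq', h'⟩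
        refine ⟨p * q' + p' * q, q * q', by simp [hq, hq'], ?_⟩
        simp only [map_mul, map_add]
        linear_combination Polynomial.aeval τ q' * h + Polynomial.aeval τ q * h'
      smul_mem' := by
        rintro c f ⟨p, q, hq, h⟩
        refine ⟨Polynomial.C c * p, q, hq, ?_⟩
        simp only [map_mul, Polynomial.aeval_C, Algebra.smul_def]
        linear_combination algebraMap K L c * h }
  have mem_J (b : K) (p : Polynomial K) (s : Finset ℕ) (d : ℕ → K) (hd : ∀ i ∈ s, d i ≠ b) :
      (τ + algebraMap K L b) * Polynomial.aeval τ p * ∏ i ∈ s, (τ + algebraMap K L (d i))⁻¹ ∈ J b := by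
    refine ⟨p, ∏ i ∈ s, (Polynomial.X + Polynomial.C (d i)), ?_, ?_⟩
    · simp only [Polynomial.eval_prod, Polynomial.eval_add, Polynomial.eval_X, Polynomial.eval_C]
      refine Finset.prod_ne_zero_iff.2 fun i hi h => hd i hi ?_
      linear_combination h
    · simp only [map_prod, map_add, Polynomial.aeval_X, Polynomial.aeval_C, Finset.prod_inv_distrib]
      have : ∏ i ∈ s, (τ + algebraMap K L (d i)) ≠ 0 :=
        Finset.prod_ne_zero_iff.2 fun i _ => hne _
      field_simp
  have const_mem_J (b c : K) (h : algebraMap K L c ∈ J b) : c = 0 := by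
    obtain ⟨p, q, hq, h⟩ := h
    have h0 : Polynomial.C c * q - (Polynomial.X + Polynomial.C b) * p = 0 :=
      transcendental_iff.1 hτ _ (by simp [h])
    have := congrArg (Polynomial.eval (-b)) h0
    simpa [hq] using this
  rw [linearIndependent_iff']
  intro s g hg
  have hsome : ∀ p : ι × ℕ, some p ∈ s → g (some p) = 0 := by
    by_contra! hcon
    obtain ⟨p₀, hp₀, hgp₀⟩ := hcon
    obtain ⟨⟨c, N⟩, hmem, hmax⟩ := Finset.exists_max_image
      (s.eraseNone.filter fun p => g (some p) ≠ 0) (fun p => p.2) ⟨p₀, by simp [hp₀, hgp₀]⟩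
    simp only [Finset.mem_filter, Finset.mem_eraseNone] at hmem hmax
    refine hmem.2 (const_mem_J (a c N) _ ?_)
    set D : L := ∏ i ∈ Finset.range (N + 1), (τ + algebraMap K L (a c i)) with hD
    have hD' : D = (τ + algebraMap K L (a c N)) *
        Polynomial.aeval τ (∏ i ∈ Finset.range N, (Polynomial.X + Polynomial.C (a c i))) := by
      simp [hD, Finset.prod_range_succ, mul_comm]
    have hg' := congrArg (· * D) hg
    simp only [zero_mul, Finset.sum_mul] at hg'
    rw [← Finset.add_sum_erase _ _ hmem.1] at hg'
    have hlead : g (some (c, N)) • (∏ i ∈ Finset.range (N + 1),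
        (τ + algebraMap K L (a c i))⁻¹) * D = algebraMap K L (g (some (c, N))) := by
      rw [Algebra.smul_def, mul_assoc, Finset.prod_inv_distrib, inv_mul_cancel₀, mul_one]
      exact Finset.prod_ne_zero_iff.2 fun i _ => hne _
    simp only [Option.elim_some] at hg'
    rw [hlead] at hg'
    rw [eq_neg_of_add_eq_zero_left hg']
    refine neg_mem (sum_mem fun o ho => ?_)
    rw [smul_mul_assoc]
    rcases o with _ | ⟨c', k⟩
    · refine Submodule.smul_mem _ _ ?_
      have := mem_J (a c N) (∏ i ∈ Finset.range N, (Polynomial.X + Polynomial.C (a c i))) ∅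
        (fun _ => 0) (by simp)
      simpa [hD'] using this
    · by_cases hz : g (some (c', k)) = 0
      · simp [hz]
      refine Submodule.smul_mem _ _ ?_
      have hk : k ≤ N := hmax (c', k) ⟨Finset.mem_of_mem_erase ho, hz⟩
      simp only [Option.elim_some]
      by_cases hc : c' = c
      · subst hc
        have hkN : k < N := lt_of_le_of_ne hk fun h => Finset.ne_of_mem_erase ho (by rw [h])
        have hprod : (∏ i ∈ Finset.range (k + 1), (τ + algebraMap K L (a c' i))⁻¹) * D =
            (τ + algebraMap K L (a c' N)) *
              Polynomial.aeval τ (∏ i ∈ Finset.Ico (k + 1) N, (Polynomial.X + Polynomial.C (a c' i))) := by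
          rw [hD', Finset.range_eq_Ico, Finset.range_eq_Ico,
            ← Finset.prod_Ico_consecutive _ (Nat.zero_le (k + 1)) hkN, map_mul,
            Finset.prod_inv_distrib]
          have : ∏ i ∈ Finset.Ico 0 (k + 1), (τ + algebraMap K L (a c' i)) ≠ 0 :=
            Finset.prod_ne_zero_iff.2 fun i _ => hne _
          simp only [map_prod, map_add, Polynomial.aeval_X, Polynomial.aeval_C]
          field_simp
        rw [hprod]
        simpa only [Finset.prod_empty, mul_one] using mem_J (a c' N)
          (∏ i ∈ Finset.Ico (k + 1) N, (Polynomial.X + Polynomial.C (a c' i))) ∅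
          (fun _ => 0) (by simp)
      · rw [hD', mul_comm]
        exact mem_J _ _ _ _ fun i _ => ha _ _ _ _ hc
  rintro (_ | p) ho
  · rw [Finset.sum_eq_single none] at hg
    · simpa using hg
    · rintro (_ | p) hp hne
      · exact absurd rfl hne
      · simp [hsome p hp]
    · exact fun h => absurd ho h
  · exact hsome p ho

section Localization

variable {r : ℕ} {U : Submodule (ZMod 2) (W r)}

/-- The ring presented by the generators `x_λ`, `e_μ` and the relations in `locIdeal U`. -/
abbrev LocRing (U : Submodule (ZMod 2) (W r)) : Type :=
  MvPolynomial (ChiP U ⊕ ChiM U) (ZMod 2) ⧸ locIdeal U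

open scoped Classical in
/-- The class of `x_w`, extended by zero to `w ∈ U`. -/
noncomputable def thomInv (U : Submodule (ZMod 2) (W r)) (w : W r) : LocRing U :=
  if h : w ∉ U then Ideal.Quotient.mk _ (X (Sum.inl ⟨w, h⟩)) else 0

open scoped Classical in
/-- The class of `e_w`, extended by zero to `w = 0` and to `w ∉ U`. -/
noncomputable def preEuler (U : Submodule (ZMod 2) (W r)) (w : W r) : LocRing U :=
  if h : w ∈ U ∧ w ≠ 0 then Ideal.Quotient.mk _ (X (Sum.inr ⟨w, h⟩)) else 0

theorem add_eq_zero_iff_eq_of_zmod_two {G : Type*} [AddCommGroup G] [Module (ZMod 2) G]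
    {a b : G} : a + b = 0 ↔ a = b := by
  rw [← ZModModule.sub_eq_add, sub_eq_zero]

@[simp]
theorem preEuler_zero : preEuler U 0 = 0 := by
  simp [preEuler]

theorem thomInv_mul_thomInv {v w : W r} (hv : v ∉ U) (hw : w ∉ U) (hvw : v + w ∉ U) :
    thomInv U v * thomInv U w = thomInv U (v + w) * (thomInv U v + thomInv U w) := by
  apply add_eq_zero_iff_eq_of_zmod_two.1
  rw [thomInv, thomInv, thomInv, dif_pos hv, dif_pos hw, dif_pos hvw]
  have := (Ideal.Quotient.eq_zero_iff_mem (I := locIdeal U)).2 (Ideal.subset_span (Or.inl (Or.inl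
    ⟨⟨v, hv⟩, ⟨w, hw⟩, ⟨v + w, hvw⟩, ZModModule.add_self (v + w), rfl⟩)))
  simp only [map_add, map_mul] at this
  linear_combination this

theorem thomInv_mul_thomInv_mul_preEuler {v w : W r} (hv : v ∉ U) (hw : w ∉ U)
    (hvw : v + w ∈ U) :
    thomInv U v * thomInv U w * preEuler U (v + w) = thomInv U v + thomInv U w := by
  by_cases h0 : v + w = 0
  · rw [add_eq_zero_iff_eq_of_zmod_two.1 h0, ZModModule.add_self, ZModModule.add_self,
      preEuler_zero, mul_zero]
  symm
  apply add_eq_zero_iff_eq_of_zmod_two.1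
  rw [thomInv, thomInv, preEuler, dif_pos hv, dif_pos hw, dif_pos ⟨hvw, h0⟩]
  have := (Ideal.Quotient.eq_zero_iff_mem (I := locIdeal U)).2 (Ideal.subset_span (Or.inl (Or.inr
    ⟨⟨v, hv⟩, ⟨w, hw⟩, ⟨v + w, hvw, h0⟩, ZModModule.add_self (v + w), rfl⟩)))
  simp only [map_add, map_mul] at this
  exact this

theorem preEuler_add {v w : W r} (hv : v ∈ U) (hw : w ∈ U) :
    preEuler U (v + w) = preEuler U v + preEuler U w := by
  by_cases hv0 : v = 0
  · rw [hv0, preEuler_zero, zero_add, zero_add]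
  by_cases hw0 : w = 0
  · rw [hw0, preEuler_zero, add_zero, add_zero]
  by_cases h0 : v + w = 0
  · rw [add_eq_zero_iff_eq_of_zmod_two.1 h0, ZModModule.add_self, ZModModule.add_self,
      preEuler_zero]
  symm
  apply add_eq_zero_iff_eq_of_zmod_two.1
  rw [preEuler, preEuler, preEuler, dif_pos ⟨hv, hv0⟩, dif_pos ⟨hw, hw0⟩,
    dif_pos ⟨add_mem hv hw, h0⟩]
  have := (Ideal.Quotient.eq_zero_iff_mem (I := locIdeal U)).2 (Ideal.subset_span (Or.inr
    ⟨⟨v, hv, hv0⟩, ⟨w, hw, hw0⟩, ⟨v + w, add_mem hv hw, h0⟩, ZModModule.add_self (v + w), rfl⟩))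
  simp only [map_add] at this
  exact this

/-- The subalgebra generated by the `x_w` and `e_w` with `w ∈ V`. -/
noncomputable def levelSubalgebra (U V : Submodule (ZMod 2) (W r)) :
    Subalgebra (ZMod 2) (LocRing U) :=
  Algebra.adjoin (ZMod 2) (thomInv U '' V ∪ preEuler U '' V)

theorem thomInv_mem_levelSubalgebra {V : Submodule (ZMod 2) (W r)} {w : W r} (hw : w ∈ V) :
    thomInv U w ∈ levelSubalgebra U V :=
  Algebra.subset_adjoin (Or.inl ⟨w, hw, rfl⟩)

theorem preEuler_mem_levelSubalgebra {V : Submodule (ZMod 2) (W r)} {w : W r} (hw : w ∈ V) :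
    preEuler U w ∈ levelSubalgebra U V :=
  Algebra.subset_adjoin (Or.inr ⟨w, hw, rfl⟩)

theorem levelSubalgebra_top : levelSubalgebra U ⊤ = ⊤ := by
  rw [eq_top_iff]
  rintro a -
  obtain ⟨p, rfl⟩ := Ideal.Quotient.mk_surjective a
  induction p using MvPolynomial.induction_on with
  | C c => exact (levelSubalgebra U ⊤).algebraMap_mem c
  | add p q hp hq => rw [map_add]; exact add_mem hp hq
  | mul_X p i hp =>
    rw [map_mul]
    refine mul_mem hp ?_
    rcases i with ⟨w, hw⟩ | ⟨w, hw⟩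
    · have := thomInv_mem_levelSubalgebra (U := U) (V := ⊤) (w := w) trivial
      rwa [thomInv, dif_pos hw] at this
    · have := preEuler_mem_levelSubalgebra (U := U) (V := ⊤) (w := w) trivial
      rwa [preEuler, dif_pos hw] at this

section Span

variable {V : Submodule (ZMod 2) (W r)} {t : W r} (u : ℕ → U)

/-- The product of `x_λ` over the first `k` terms of an enumeration of a coset of `U`. -/
noncomputable def cosetProd (C : W r ⧸ U) (k : ℕ) : LocRing U :=
  ∏ i ∈ Finset.range k, thomInv U (C.out + u i)

/-- The cosets of `U` contained in `t + V`. -/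
abbrev CosetIn (U V : Submodule (ZMod 2) (W r)) (t : W r) : Type :=
  {C : W r ⧸ U // C.out + t ∈ V}

/-- The candidate basis of the level of `V + ⟨t⟩` over the level of `V`. -/
noncomputable def cosetMonomial (V : Submodule (ZMod 2) (W r)) (t : W r)
    (o : Option (CosetIn U V t × ℕ)) : LocRing U :=
  o.elim 1 fun p => cosetProd u p.1.1 (p.2 + 1)

theorem cosetProd_mem_span (C : CosetIn U V t) (k : ℕ) :
    cosetProd u C.1 k ∈
      Submodule.span (levelSubalgebra U V) (Set.range (cosetMonomial u V t)) := by
  rcases k with _ | k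
  · exact Submodule.subset_span ⟨none, by simp [cosetMonomial, cosetProd]⟩
  · exact Submodule.subset_span ⟨some (C, k), rfl⟩

theorem mul_mem_span {a b : LocRing U} (ha : a ∈ levelSubalgebra U V)
    (hb : b ∈ Submodule.span (levelSubalgebra U V) (Set.range (cosetMonomial u V t))) :
    a * b ∈ Submodule.span (levelSubalgebra U V) (Set.range (cosetMonomial u V t)) :=
  Submodule.smul_mem _ (⟨a, ha⟩ : levelSubalgebra U V) hb

theorem add_mem_of_translate {v w : W r} (hv : v + t ∈ V) (hw : w + t ∈ V) : v + w ∈ V := by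
  have := add_mem hv hw
  rwa [add_add_add_comm, ZModModule.add_self, add_zero] at this

theorem notMem_of_translate (hUV : U ≤ V) (ht : t ∉ V) {w : W r} (hw : w + t ∈ V) : w ∉ U := by
  intro h
  exact ht ((V.add_mem_iff_right (hUV h)).1 hw)

theorem translate_of_coset (hUV : U ≤ V) (C : CosetIn U V t) (a : U) :
    C.1.out + a + t ∈ V := by
  rw [add_right_comm]
  exact add_mem C.2 (hUV a.2)

theorem thomInv_mul_cosetProd_same (hUV : U ≤ V) (ht : t ∉ V) (C : CosetIn U V t) {w : W r}
    (d : ℕ) : ∀ k, C.1.out + u (k + d) = w → thomInv U w * cosetProd u C.1 k ∈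
      Submodule.span (levelSubalgebra U V) (Set.range (cosetMonomial u V t)) := by
  induction d with
  | zero =>
    rintro k rfl
    have := cosetProd_mem_span u C (k + 1)
    rwa [cosetProd, Finset.prod_range_succ, mul_comm] at this
  | succ d ih =>
    intro k hk
    have hw : w ∉ U := hk ▸ notMem_of_translate hUV ht (translate_of_coset hUV C _)
    have hv : C.1.out + u k ∉ U := notMem_of_translate hUV ht (translate_of_coset hUV C _)
    have hwv : w + (C.1.out + u k) ∈ U := by
      rw [← hk, add_add_add_comm, ZModModule.add_self, zero_add]
      exact add_mem (u _).2 (u _).2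
    have hrel := thomInv_mul_thomInv_mul_preEuler hw hv hwv
    have hsucc : cosetProd u C.1 (k + 1) =
        cosetProd u C.1 k * thomInv U (C.1.out + u k) := Finset.prod_range_succ _ _
    have hexp : thomInv U w * cosetProd u C.1 k =
        cosetProd u C.1 (k + 1) + preEuler U (w + (C.1.out + u k)) *
          (thomInv U w * cosetProd u C.1 (k + 1)) := by
      rw [hsucc]
      linear_combination cosetProd u C.1 k * (-hrel - ZModModule.add_self (thomInv U (C.1.out + u k)))
    rw [hexp]
    exact add_mem (cosetProd_mem_span u C _) (mul_mem_span u
      (preEuler_mem_levelSubalgebra (hUV hwv)) (ih (k + 1) (by rw [← hk]; congr 3; omega)))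

theorem thomInv_mul_cosetProd (hUV : U ≤ V) (ht : t ∉ V) (hu : ∀ a k, ∃ d, u (k + d) = a)
    (C : CosetIn U V t) {w : W r} (hw : w + t ∈ V) (k : ℕ) :
    thomInv U w * cosetProd u C.1 k ∈
      Submodule.span (levelSubalgebra U V) (Set.range (cosetMonomial u V t)) := by
  have same (C : CosetIn U V t) (hC : C.1.out + w ∈ U) (k : ℕ) :
      thomInv U w * cosetProd u C.1 k ∈
        Submodule.span (levelSubalgebra U V) (Set.range (cosetMonomial u V t)) := by
    obtain ⟨d, hd⟩ := hu ⟨_, hC⟩ k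
    refine thomInv_mul_cosetProd_same u hUV ht C d k ?_
    rw [hd, ← add_assoc, ZModModule.add_self, zero_add]
  by_cases hC : C.1.out + w ∈ U
  · exact same C hC k
  induction k with
  | zero =>
    have hout : (Submodule.Quotient.mk w : W r ⧸ U).out + w ∈ U := by
      have := (Submodule.Quotient.eq U).1 (Quotient.out_eq (Submodule.Quotient.mk w : W r ⧸ U))
      have h2 := ZModModule.add_self w
      rwa [sub_eq_add_neg, ← eq_neg_of_add_eq_zero_left h2] at this
    have hmem : (Submodule.Quotient.mk w : W r ⧸ U).out + t ∈ V := by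
      have := add_mem (hUV hout) hw
      rwa [add_add_add_comm, add_right_comm, ← add_assoc, add_right_comm _ w t, add_assoc,
        add_assoc, ZModModule.add_self, add_zero] at this
    simpa [cosetProd] using same ⟨_, hmem⟩ hout 0
  | succ k ih =>
    have hk : C.1.out + u k + t ∈ V := translate_of_coset hUV C _
    have hv : C.1.out + u k ∉ U := notMem_of_translate hUV ht hk
    have hwv : w + (C.1.out + u k) ∉ U := by
      rw [← add_assoc, add_comm w, U.add_mem_iff_left (u k).2]
      exact hC
    have hrel := thomInv_mul_thomInv (notMem_of_translate hUV ht hw) hv hwv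
    have hsucc : cosetProd u C.1 (k + 1) =
        cosetProd u C.1 k * thomInv U (C.1.out + u k) := Finset.prod_range_succ _ _
    have hexp : thomInv U w * cosetProd u C.1 (k + 1) =
        thomInv U (w + (C.1.out + u k)) *
          (thomInv U w * cosetProd u C.1 k + cosetProd u C.1 (k + 1)) := by
      rw [hsucc]
      linear_combination cosetProd u C.1 k * hrel
    rw [hexp]
    exact mul_mem_span u (thomInv_mem_levelSubalgebra (add_mem_of_translate hw hk))
      (add_mem ih (cosetProd_mem_span u C _))

theorem mem_or_translate_mem {w : W r} (hw : w ∈ V ⊔ Submodule.span (ZMod 2) {t}) :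
    w ∈ V ∨ w + t ∈ V := by
  obtain ⟨v, hv, y, hy, rfl⟩ := Submodule.mem_sup.1 hw
  obtain ⟨c, rfl⟩ := Submodule.mem_span_singleton.1 hy
  have hc : ∀ c : ZMod 2, c = 0 ∨ c = 1 := by decide
  rcases hc c with rfl | rfl
  · left
    simpa using hv
  · right
    rwa [one_smul, add_assoc, ZModModule.add_self, add_zero]

theorem levelSubalgebra_sup_le_span (hUV : U ≤ V) (ht : t ∉ V)
    (hu : ∀ a k, ∃ d, u (k + d) = a) {a : LocRing U}
    (ha : a ∈ levelSubalgebra U (V ⊔ Submodule.span (ZMod 2) {t})) :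
    a ∈ Submodule.span (levelSubalgebra U V) (Set.range (cosetMonomial u V t)) := by
  suffices h : ∀ b ∈ Submodule.span (levelSubalgebra U V) (Set.range (cosetMonomial u V t)),
      a * b ∈ Submodule.span (levelSubalgebra U V) (Set.range (cosetMonomial u V t)) by
    simpa using h 1 (Submodule.subset_span ⟨none, rfl⟩)
  induction ha using Algebra.adjoin_induction with
  | algebraMap c => exact fun b hb => mul_mem_span u (Subalgebra.algebraMap_mem _ c) hb
  | add a a' _ _ h h' =>
    intro b hb
    rw [add_mul]
    exact add_mem (h b hb) (h' b hb)
  | mul a a' _ _ h h' =>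
    intro b hb
    rw [mul_assoc]
    exact h _ (h' b hb)
  | mem a ha =>
    intro b hb
    rcases ha with ⟨w, hw, rfl⟩ | ⟨w, hw, rfl⟩
    · rcases mem_or_translate_mem hw with hw | hw
      · exact mul_mem_span u (thomInv_mem_levelSubalgebra hw) hb
      · induction hb using Submodule.span_induction with
        | zero => simp
        | add b b' _ _ h h' =>
          rw [mul_add]
          exact add_mem h h'
        | smul c b _ h =>
          rw [mul_smul_comm]
          exact Submodule.smul_mem _ _ h
        | mem b hb =>
          obtain ⟨_ | ⟨C, k⟩, rfl⟩ := hb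
          · have hC : (Submodule.Quotient.mk w : W r ⧸ U).out + t ∈ V := by
              have hout := (Submodule.Quotient.eq U).1
                (Quotient.out_eq (Submodule.Quotient.mk w : W r ⧸ U))
              have := add_mem (hUV hout) hw
              rwa [← add_assoc, sub_add_cancel] at this
            simpa [cosetProd, cosetMonomial] using
              thomInv_mul_cosetProd u hUV ht hu ⟨_, hC⟩ hw 0
          · exact thomInv_mul_cosetProd u hUV ht hu C hw (k + 1)
    · by_cases hwU : w ∈ U
      · exact mul_mem_span u (preEuler_mem_levelSubalgebra (hUV hwU)) hb
      · simp [preEuler, hwU]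

end Span

section Realization

variable {L : Type*} [Field L] [Algebra (ZMod 2) L] (ℓ : W r →ₗ[ZMod 2] L)

/-- The realization of `LocRing U` by the rational functions `x_λ = 1 / λ` and `e_μ = μ`, for an
injective realization `ℓ` of the characters in a field. -/
noncomputable def realization (U : Submodule (ZMod 2) (W r)) (hℓ : Function.Injective ℓ) :
    LocRing U →ₐ[ZMod 2] L :=
  Ideal.Quotient.liftₐ (locIdeal U)
    (MvPolynomial.aeval (Sum.elim (fun w : ChiP U => (ℓ w)⁻¹) fun w : ChiM U => ℓ w)) <| by
      have hne (w : ChiP U) : ℓ w ≠ 0 := by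
        rw [Ne, map_eq_zero_iff ℓ hℓ]
        rintro h
        exact w.2 (h ▸ U.zero_mem)
      have hadd {w₁ w₂ w₃ : W r} (h : w₁ + w₂ + w₃ = 0) : ℓ w₁ + ℓ w₂ + ℓ w₃ = 0 := by
        rw [← map_add, ← map_add, h, map_zero]
      intro p hp
      rw [← RingHom.mem_ker]
      refine (Ideal.span_le (I := RingHom.ker _)).2 ?_ hp
      rintro _ ((⟨α, β, γ, h, rfl⟩ | ⟨α, β, γ, h, rfl⟩) | ⟨α, β, γ, h, rfl⟩)
      · have := hne α
        have := hne β
        have := hne γ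
        simp only [SetLike.mem_coe, RingHom.mem_ker, map_add, map_mul, aeval_X, Sum.elim_inl]
        field_simp
        linear_combination hadd h
      · have := hne α
        have := hne β
        simp only [SetLike.mem_coe, RingHom.mem_ker, map_add, map_mul, aeval_X, Sum.elim_inl,
          Sum.elim_inr]
        field_simp
        linear_combination hadd h
      · simpa only [SetLike.mem_coe, RingHom.mem_ker, map_add, aeval_X, Sum.elim_inr] using hadd h

variable (hℓ : Function.Injective ℓ)

theorem realization_thomInv {w : W r} (hw : w ∉ U) :
    realization ℓ U hℓ (thomInv U w) = (ℓ w)⁻¹ := by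
  rw [thomInv, dif_pos hw]
  exact (MvPolynomial.aeval_X _ _).trans rfl

theorem realization_preEuler {w : W r} (hw : w ∈ U) :
    realization ℓ U hℓ (preEuler U w) = ℓ w := by
  by_cases h0 : w = 0
  · simp [h0]
  rw [preEuler, dif_pos ⟨hw, h0⟩]
  exact (MvPolynomial.aeval_X _ _).trans rfl

theorem realization_mem_subfield (K : Subfield L) {V : Submodule (ZMod 2) (W r)}
    (hK : ∀ w ∈ V, ℓ w ∈ K) {a : LocRing U} (ha : a ∈ levelSubalgebra U V) :
    realization ℓ U hℓ a ∈ K := by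
  induction ha using Algebra.adjoin_induction with
  | algebraMap c =>
    rw [AlgHom.commutes]
    have hc : ∀ c : ZMod 2, c = 0 ∨ c = 1 := by decide
    rcases hc c with rfl | rfl <;> simp
  | add a b _ _ ha hb => rw [map_add]; exact add_mem ha hb
  | mul a b _ _ ha hb => rw [map_mul]; exact mul_mem ha hb
  | mem a ha =>
    rcases ha with ⟨w, hw, rfl⟩ | ⟨w, hw, rfl⟩
    · by_cases hwU : w ∈ U
      · simp [thomInv, hwU]
      · rw [realization_thomInv ℓ hℓ hwU]
        exact inv_mem (hK w hw)
    · by_cases hwU : w ∈ U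
      · rw [realization_preEuler ℓ hℓ hwU]
        exact hK w hw
      · simp [preEuler, hwU]

/-- If `realization` is injective on the level of `V`, then also on the level of `V + ⟨t⟩`. -/
theorem realization_injOn_sup {V : Submodule (ZMod 2) (W r)} {t : W r} (hUV : U ≤ V) (ht : t ∉ V)
    (K : Subfield L) (hK : ∀ w ∈ V, ℓ w ∈ K) (hτ : Transcendental K (ℓ t))
    (hV : ∀ a ∈ levelSubalgebra U V, realization ℓ U hℓ a = 0 → a = 0) :
    ∀ a ∈ levelSubalgebra U (V ⊔ Submodule.span (ZMod 2) {t}),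
      realization ℓ U hℓ a = 0 → a = 0 := by
  obtain ⟨f, hf⟩ := exists_surjective_nat U
  let u : ℕ → U := fun k => f k.unpair.1
  have hu : ∀ a k, ∃ d, u (k + d) = a := by
    intro a k
    obtain ⟨m, rfl⟩ := hf a
    refine ⟨Nat.pair m k - k, ?_⟩
    simp only [u]
    rw [Nat.add_sub_cancel' (Nat.right_le_pair m k), Nat.unpair_pair]
  intro a ha ha0
  obtain ⟨c, rfl⟩ := Finsupp.mem_span_range_iff_exists_finsupp.1
    (levelSubalgebra_sup_le_span u hUV ht hu ha)
  let pole : CosetIn U V t → ℕ → K := fun C i => ⟨ℓ (C.1.out + u i + t),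
    hK _ (translate_of_coset hUV C _)⟩
  have hpole : ∀ C C' i j, C ≠ C' → pole C i ≠ pole C' j := by
    intro C C' i j hne h
    apply hne
    have h1 := add_right_cancel (hℓ (Subtype.ext_iff.1 h))
    apply Subtype.ext
    rw [← Quotient.out_eq C.1, ← Quotient.out_eq C'.1]
    refine (Submodule.Quotient.eq U).2 ?_
    rw [show C.1.out - C'.1.out = (u j - u i : W r) by
      rw [sub_eq_sub_iff_add_eq_add, h1, add_comm]]
    exact sub_mem (u j).2 (u i).2
  have hmono (o : Option (CosetIn U V t × ℕ)) :
      realization ℓ U hℓ (cosetMonomial u V t o) = o.elim (1 : L) fun p =>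
        ∏ i ∈ Finset.range (p.2 + 1), (ℓ t + algebraMap K L (pole p.1 i))⁻¹ := by
    rcases o with _ | ⟨C, k⟩
    · simp [cosetMonomial]
    · simp only [cosetMonomial, Option.elim_some, cosetProd, map_prod]
      refine Finset.prod_congr rfl fun i _ => ?_
      rw [realization_thomInv ℓ hℓ (notMem_of_translate hUV ht (translate_of_coset hUV C _))]
      change _ = (ℓ t + ℓ (C.1.out + u i + t))⁻¹
      rw [← map_add, add_left_comm, ZModModule.add_self, add_zero]
  have hli := linearIndependent_iff'.1 (linearIndependent_prod_inv hτ pole hpole) c.support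
    (fun o => ⟨realization ℓ U hℓ (c o), realization_mem_subfield ℓ hℓ K hK (c o).2⟩) (by
      rw [Finsupp.sum, map_sum] at ha0
      rw [← ha0]
      refine Finset.sum_congr rfl fun o _ => ?_
      rw [Subalgebra.smul_def, smul_eq_mul, map_mul, hmono]
      rfl)
  refine Finset.sum_eq_zero fun o ho => ?_
  have hco : c o = 0 := Subtype.ext (hV (c o) (c o).2 (congrArg Subtype.val (hli o ho)))
  simp only [hco, zero_smul]

end Realization

section SymmetricAlgebra

/-- Realization by rational functions is injective on the subalgebra generated by the `e_μ`. -/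
theorem realization_injOn_base {L : Type*} [Field L] [Algebra (ZMod 2) L]
    [Algebra (SymmetricAlgebra (ZMod 2) (W r)) L]
    [IsScalarTower (ZMod 2) (SymmetricAlgebra (ZMod 2) (W r)) L]
    [FaithfulSMul (SymmetricAlgebra (ZMod 2) (W r)) L] (ℓ : W r →ₗ[ZMod 2] L)
    (hℓ : Function.Injective ℓ)
    (hι : ∀ w, ℓ w = algebraMap _ L (SymmetricAlgebra.ι (ZMod 2) (W r) w)) :
    ∀ a ∈ levelSubalgebra U U, realization ℓ U hℓ a = 0 → a = 0 := by
  let e : U →ₗ[ZMod 2] LocRing U := AddMonoidHom.toZModLinearMap 2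
    { toFun := fun w => preEuler U w
      map_zero' := preEuler_zero
      map_add' := fun v w => preEuler_add v.2 w.2 }
  obtain ⟨g, hg⟩ := LinearMap.exists_extend e
  have key : ∀ a ∈ levelSubalgebra U U, ∃ s : SymmetricAlgebra (ZMod 2) (W r),
      SymmetricAlgebra.lift g s = a ∧ algebraMap _ L s = realization ℓ U hℓ a := by
    intro a ha
    induction ha using Algebra.adjoin_induction with
    | algebraMap c =>
      refine ⟨algebraMap _ _ c, AlgHom.commutes _ c, ?_⟩
      rw [AlgHom.commutes, ← IsScalarTower.algebraMap_apply]
    | add a b _ _ ha hb =>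
      obtain ⟨s, rfl, hs⟩ := ha
      obtain ⟨s', rfl, hs'⟩ := hb
      exact ⟨s + s', map_add _ _ _, by rw [map_add, map_add, hs, hs']⟩
    | mul a b _ _ ha hb =>
      obtain ⟨s, rfl, hs⟩ := ha
      obtain ⟨s', rfl, hs'⟩ := hb
      exact ⟨s * s', map_mul _ _ _, by rw [map_mul, map_mul, hs, hs']⟩
    | mem a ha =>
      rcases ha with ⟨w, hw, rfl⟩ | ⟨w, hw, rfl⟩
      · have : thomInv U w = 0 := dif_neg (not_not.2 hw)
        exact ⟨0, by rw [this, map_zero], by rw [this, map_zero, map_zero]⟩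
      · refine ⟨SymmetricAlgebra.ι _ _ w, ?_, ?_⟩
        · rw [SymmetricAlgebra.lift_ι_apply]
          exact DFunLike.congr_fun hg ⟨w, hw⟩
        · rw [← hι, realization_preEuler ℓ hℓ hw]
  intro a ha ha0
  obtain ⟨s, rfl, hs⟩ := key a ha
  rw [ha0] at hs
  rw [(FaithfulSMul.algebraMap_eq_zero_iff _ L).1 hs, map_zero]

end SymmetricAlgebra

end Localization

/-- The localized twisted cohomology ring `H(A|B)`, presented as the quotient of `Q`
by the three families of relations, is an integral domain. -/
theorem stmt13 (r : ℕ) (U : Submodule (ZMod 2) (W r)) :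
    IsDomain (MvPolynomial (ChiP U ⊕ ChiM U) (ZMod 2) ⧸ locIdeal U) := by
  let S := SymmetricAlgebra (ZMod 2) (W r)
  let L := FractionRing S
  let ℓ : W r →ₗ[ZMod 2] L :=
    (Algebra.linearMap S L).restrictScalars (ZMod 2) ∘ₗ SymmetricAlgebra.ι (ZMod 2) (W r)
  have hℓ : Function.Injective ℓ := by
    rw [injective_iff_map_eq_zero]
    intro w hw
    by_contra h0
    obtain ⟨K, -, hK⟩ := exists_subfield_transcendental L (⊥ : Submodule (ZMod 2) (W r)) h0
    refine hK ?_
    rw [show algebraMap S L (SymmetricAlgebra.ι _ _ w) = 0 from hw]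
    exact isAlgebraic_zero
  let Good (V : Submodule (ZMod 2) (W r)) : Prop :=
    U ≤ V ∧ ∀ a ∈ levelSubalgebra U V, realization ℓ U hℓ a = 0 → a = 0
  obtain ⟨V, ⟨hUV, hV⟩, hmax⟩ := (wellFounded_gt (α := Submodule (ZMod 2) (W r))).has_min {V | Good V}
    ⟨U, le_rfl, realization_injOn_base ℓ hℓ fun _ => rfl⟩
  have hVtop : V = ⊤ := by
    by_contra hne
    obtain ⟨t, -, ht⟩ := SetLike.exists_of_lt (lt_top_iff_ne_top.2 hne)
    obtain ⟨K, hK, hτ⟩ := exists_subfield_transcendental L V ht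
    refine hmax _ ⟨hUV.trans le_sup_left, realization_injOn_sup ℓ hℓ hUV ht K hK hτ hV⟩ ?_
    exact left_lt_sup.2 fun h => ht (h (Submodule.mem_span_singleton_self t))
  have hinj : Function.Injective (realization ℓ U hℓ) := by
    rw [injective_iff_map_eq_zero]
    exact fun a => hV a (by rw [hVtop, levelSubalgebra_top]; trivial)
  exact hinj.isDomain (realization ℓ U hℓ)
end

section
/- The quotient of the polynomial ring MvPolynomial χ (ZMod 2), with one variable x_λ for each λ ∈ χ, by the ideal generated by the quadratic polynomials x_α·x_β + x_α·x_γ + x_β·x_γ for all α, β, γ ∈ χ with α + β + γ = 0, is an integral domain. (This ring is the Holler–Kriz presentation of the geometric fixed point ring Φ^A_*(HF₂) of the mod-2 Eilenberg–MacLane spectrum for an elementary abelian 2-group A of rank r, i.e. the localization H(A|A); the paper proves it is a domain.) -/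
open MvPolynomial

/-- The Holler–Kriz ideal: generated by `x_α x_β + x_α x_γ + x_β x_γ` for all triples
of nonzero vectors with `α + β + γ = 0`. -/
noncomputable def hkIdeal (r : ℕ) : Ideal (MvPolynomial (Chi r) (ZMod 2)) :=
  Ideal.span {p | ∃ α β γ : Chi r, α.val + β.val + γ.val = 0 ∧
    p = X α * X β + X α * X γ + X β * X γ}

/-- If the products of distinct `y v`, `y w` are `R`-linear combinations of `y v` and `y w`, then the
`R`-span of the pure powers of the `y w` is stable under multiplication by each `y v`. -/
lemma mul_mem_span_range_pow {R Q V : Type*} [CommRing R] [CommRing Q] [Algebra R Q] (y : V → Q)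
    (hy : ∀ v w, v ≠ w → ∃ a : R, y v * y w = a • (y v + y w)) (v : V) {q : Q}
    (hq : q ∈ Submodule.span R (Set.range fun p : V × ℕ => y p.1 ^ p.2)) :
    y v * q ∈ Submodule.span R (Set.range fun p : V × ℕ => y p.1 ^ p.2) := by
  have hmem (w : V) (e : ℕ) :
      y w ^ e ∈ Submodule.span R (Set.range fun p : V × ℕ => y p.1 ^ p.2) :=
    Submodule.subset_span ⟨(w, e), rfl⟩
  induction hq using Submodule.span_induction with
  | mem x hx =>
    obtain ⟨⟨w, e⟩, rfl⟩ := hx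
    rcases eq_or_ne v w with rfl | hvw
    · simpa [pow_succ'] using hmem v (e + 1)
    · obtain ⟨a, ha⟩ := hy v w hvw
      induction e with
      | zero => simpa using hmem v 1
      | succ e ih =>
        have h : y v * y w ^ (e + 1) = a • (y v * y w ^ e + y w ^ (e + 1)) := by
          rw [pow_succ', ← mul_assoc, ha, smul_mul_assoc, add_mul]
        simp only at ih ⊢
        rw [h]
        exact Submodule.smul_mem _ _ (Submodule.add_mem _ ih (hmem w (e + 1)))
  | zero => simp
  | add x z _ _ hx hz => rw [mul_add]; exact Submodule.add_mem _ hx hz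
  | smul a x _ hx => rw [mul_smul_comm]; exact Submodule.smul_mem _ _ hx

/-- Elements of the span of pure powers, as a constant plus finitely many positive powers. -/
lemma exists_eq_add_sum_of_mem_span_range_pow {R Q V : Type*} [CommRing R] [CommRing Q]
    [Algebra R Q] [Fintype V] (y : V → Q) {q : Q}
    (hq : q ∈ Submodule.span R (Set.range fun p : V × ℕ => y p.1 ^ p.2)) :
    ∃ (c : R) (N : ℕ) (d : V → Fin N → R),
      q = algebraMap R Q c + ∑ w, ∑ j, algebraMap R Q (d w j) * y w ^ (j.1 + 1) := by
  classical
  suffices h : ∃ (c : R) (d : V → Polynomial R),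
      q = algebraMap R Q c + ∑ w, y w * Polynomial.aeval (y w) (d w) by
    obtain ⟨c, d, rfl⟩ := h
    refine ⟨c, Finset.univ.sup (fun w => (d w).natDegree) + 1, fun w j => (d w).coeff j, ?_⟩
    congr 1
    refine Finset.sum_congr rfl fun w _ => ?_
    rw [Polynomial.aeval_eq_sum_range' (Nat.lt_succ_of_le
      (Finset.le_sup (f := fun w => (d w).natDegree) (Finset.mem_univ w))),
      Finset.mul_sum, Finset.sum_range]
    refine Finset.sum_congr rfl fun j _ => ?_
    rw [Algebra.smul_def, pow_succ]
    ring
  induction hq using Submodule.span_induction with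
  | mem x hx =>
    obtain ⟨⟨w, e⟩, rfl⟩ := hx
    cases e with
    | zero => exact ⟨1, 0, by simp⟩
    | succ e =>
      refine ⟨0, Pi.single w (Polynomial.X ^ e), ?_⟩
      rw [Finset.sum_eq_single w]
      · simp [pow_succ']
      · intro b _ hb
        simp [hb]
      · simp
  | zero => exact ⟨0, 0, by simp⟩
  | add x z _ _ hx hz =>
    obtain ⟨c, d, rfl⟩ := hx
    obtain ⟨c', d', rfl⟩ := hz
    refine ⟨c + c', d + d', ?_⟩
    simp only [map_add, Pi.add_apply, mul_add, Finset.sum_add_distrib]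
    ring
  | smul a x _ hx =>
    obtain ⟨c, d, rfl⟩ := hx
    refine ⟨a * c, a • d, ?_⟩
    simp only [smul_add, Finset.smul_sum, Pi.smul_apply, map_smul, mul_smul_comm, map_mul,
      Algebra.smul_def a (algebraMap R Q c)]

/-- Linear independence of `1` and the powers `(X + a)⁻¹ ^ (j + 1)` over the constants. -/
lemma partialFraction_eq_zero {K V : Type*} [Field K] [Fintype V] (a : V → K)
    (ha : Function.Injective a) {N : ℕ} (c : K) (d : V → Fin N → K)
    (h : algebraMap K (RatFunc K) c + ∑ w, ∑ j, algebraMap K (RatFunc K) (d w j) *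
      (RatFunc.X + algebraMap K (RatFunc K) (a w))⁻¹ ^ (j.1 + 1) = 0) :
    c = 0 ∧ ∀ w j, d w j = 0 := by
  have hC (k : K) : algebraMap K (RatFunc K) k =
      algebraMap (Polynomial K) (RatFunc K) (Polynomial.C k) := by
    rw [IsScalarTower.algebraMap_apply K (Polynomial K) (RatFunc K), Polynomial.algebraMap_eq]
  have hg (w : V) : (RatFunc.X + algebraMap K (RatFunc K) (a w)) =
      algebraMap (Polynomial K) (RatFunc K) (Polynomial.X + Polynomial.C (a w)) := by
    rw [map_add, RatFunc.algebraMap_X, hC]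
  have hne (w : V) : algebraMap (Polynomial K) (RatFunc K)
      (Polynomial.X + Polynomial.C (a w)) ≠ 0 := by
    exact RatFunc.algebraMap_ne_zero (Polynomial.X_add_C_ne_zero (a w))
  have hdeg (k : K) (w : V) : (Polynomial.C k).degree <
      (Polynomial.X + Polynomial.C (a w)).degree := by
    rw [Polynomial.degree_X_add_C]
    exact Polynomial.degree_C_le.trans_lt zero_lt_one
  have key := Polynomial.quo_add_sum_rem_mul_pow_inverse_unique (R := K) (K := RatFunc K)
    (s := Finset.univ) (g := fun w => Polynomial.X + Polynomial.C (a w)) (n := fun _ : V => N)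
    (gi := fun w => (RatFunc.X + algebraMap K (RatFunc K) (a w))⁻¹)
    (q₁ := Polynomial.C c) (q₂ := 0) (r₁ := fun w j => Polynomial.C (d w j))
    (r₂ := fun _ _ => Polynomial.C 0)
    (fun w _ => Polynomial.monic_X_add_C _)
    (fun v _ w _ hvw => by
      have := Polynomial.isCoprime_X_sub_C_of_isUnit_sub (R := K) (a := -a v) (b := -a w)
        (by rw [isUnit_iff_ne_zero]; intro h0; exact hvw (ha (by linear_combination -h0)))
      simpa using this)
    (fun w _ => by rw [hg]; exact inv_mul_cancel₀ (hne w))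
    (fun w _ j => hdeg _ w) (fun w _ j => hdeg _ w)
    (by simpa [← hC] using h)
  refine ⟨by simpa using key.1, fun w j => ?_⟩
  simpa using congrFun (key.2 w (Finset.mem_univ w)) j

/-- A vector of `W r` placed in the hyperplane `w 0 = 0` of `W (r + 1)`. -/
def lowChi {r : ℕ} (l : Chi r) : Chi (r + 1) :=
  ⟨Fin.cons 0 l.1, fun h => l.2 (by
    funext i
    simpa using congrFun h i.succ)⟩

/-- A vector of `W r` placed in the affine hyperplane `w 0 = 1` of `W (r + 1)`. -/
def highChi {r : ℕ} (w : W r) : Chi (r + 1) :=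
  ⟨Fin.cons 1 w, fun h => by simpa using congrFun h 0⟩

lemma chi_succ_cases {r : ℕ} (x : Chi (r + 1)) :
    (∃ l, x = lowChi l) ∨ ∃ w, x = highChi w := by
  obtain ⟨x, hx⟩ := x
  have h01 : x 0 = 0 ∨ x 0 = 1 := by
    generalize x 0 = a
    revert a
    decide
  rcases h01 with h | h
  · refine Or.inl ⟨⟨Fin.tail x, fun ht => hx ?_⟩, Subtype.ext ?_⟩
    · rw [← Fin.cons_self_tail x, ht, h]
      funext i
      cases i using Fin.cases <;> simp
    · simp only [lowChi]
      rw [← h, Fin.cons_self_tail]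
  · refine Or.inr ⟨Fin.tail x, Subtype.ext ?_⟩
    simp only [highChi]
    rw [← h, Fin.cons_self_tail]

/-- Reciprocals of linear forms satisfy the Holler–Kriz relations. -/
lemma hkIdeal_le_ker {r : ℕ} {K : Type*} [Field K] [Algebra (ZMod 2) K] (f : W r →+ K)
    (hf : Function.Injective f) :
    hkIdeal r ≤ RingHom.ker (aeval (R := ZMod 2) fun l : Chi r => (f l.1)⁻¹) := by
  rw [hkIdeal, Ideal.span_le]
  rintro _ ⟨α, β, γ, h, rfl⟩
  have hne (l : Chi r) : f l.1 ≠ 0 := (map_ne_zero_iff f hf).2 l.2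
  have hs : f α.1 + f β.1 + f γ.1 = 0 := by rw [← map_add, ← map_add, h, map_zero]
  have hα := hne α
  have hβ := hne β
  have hγ := hne γ
  simp only [SetLike.mem_coe, RingHom.mem_ker, map_add, map_mul, aeval_X]
  field_simp
  linear_combination hs

lemma hkIdeal_le_comap_rename (r : ℕ) :
    hkIdeal r ≤ (hkIdeal (r + 1)).comap (rename (R := ZMod 2) (lowChi (r := r))) := by
  rw [hkIdeal, Ideal.span_le]
  rintro _ ⟨α, β, γ, h, rfl⟩
  refine Ideal.subset_span ⟨lowChi α, lowChi β, lowChi γ, ?_, by simp⟩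
  funext i
  cases i using Fin.cases with
  | zero => simp [lowChi]
  | succ i => simpa [lowChi] using congrFun h i

lemma highChi_relation_mem {r : ℕ} {v w : W r} (hvw : v ≠ w) :
    ∃ l : Chi r, X (highChi v) * X (highChi w) + X (highChi v) * X (lowChi l) +
      X (highChi w) * X (lowChi l) ∈ hkIdeal (r + 1) := by
  have h0 : v + w ≠ 0 := fun h => hvw (by
    rw [← sub_eq_zero, ← h, sub_eq_add_neg, ZModModule.neg_eq_self])
  refine ⟨⟨v + w, h0⟩, Ideal.subset_span ⟨_, _, _, ?_, rfl⟩⟩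
  funext i
  cases i using Fin.cases with
  | zero => simpa [lowChi, highChi] using (by decide : (1 : ZMod 2) + 1 = 0)
  | succ i => simpa [lowChi, highChi] using ZModModule.add_self (v i + w i)

/-- Normal form modulo the Holler–Kriz ideal: each polynomial is congruent to one involving
at most one variable of the top level in each monomial. -/
lemma exists_normalForm {r : ℕ} (f : MvPolynomial (Chi (r + 1)) (ZMod 2)) :
    ∃ (c : MvPolynomial (Chi r) (ZMod 2)) (N : ℕ)
      (d : W r → Fin N → MvPolynomial (Chi r) (ZMod 2)),
      f - (rename lowChi c + ∑ w, ∑ j, rename lowChi (d w j) * X (highChi w) ^ (j.1 + 1)) ∈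
        hkIdeal (r + 1) := by
  let π := Ideal.Quotient.mk (hkIdeal (r + 1))
  let _ : Algebra (MvPolynomial (Chi r) (ZMod 2))
      (MvPolynomial (Chi (r + 1)) (ZMod 2) ⧸ hkIdeal (r + 1)) :=
    (π.comp (rename (R := ZMod 2) (lowChi (r := r))).toRingHom).toAlgebra
  have halg (p : MvPolynomial (Chi r) (ZMod 2)) :
      algebraMap _ (MvPolynomial (Chi (r + 1)) (ZMod 2) ⧸ hkIdeal (r + 1)) p =
        π (rename lowChi p) := rfl
  have hmul (v w : W r) (hvw : v ≠ w) : ∃ a : MvPolynomial (Chi r) (ZMod 2),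
      π (X (highChi v)) * π (X (highChi w)) =
        a • (π (X (highChi v)) + π (X (highChi w))) := by
    obtain ⟨l, hl⟩ := highChi_relation_mem hvw
    have hl' := Ideal.Quotient.eq_zero_iff_mem.2 hl
    refine ⟨-X l, ?_⟩
    rw [Algebra.smul_def, halg, map_neg, rename_X, map_neg]
    simp only [map_add, map_mul] at hl'
    linear_combination hl'
  have hspan : π f ∈ Submodule.span (MvPolynomial (Chi r) (ZMod 2))
      (Set.range fun p : W r × ℕ => π (X (highChi p.1)) ^ p.2) := by
    induction f using MvPolynomial.induction_on with
    | C a =>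
      have h : π (C a) = (C a : MvPolynomial (Chi r) (ZMod 2)) • 1 := by
        rw [Algebra.smul_def, halg, rename_C, mul_one]
      rw [h]
      exact Submodule.smul_mem _ _ (Submodule.subset_span ⟨(0, 0), by simp⟩)
    | add p q hp hq => rw [map_add]; exact Submodule.add_mem _ hp hq
    | mul_X p x hp =>
      rw [mul_comm, map_mul]
      rcases chi_succ_cases x with ⟨l, rfl⟩ | ⟨w, rfl⟩
      · have h : π (X (lowChi l)) * π p = (X l : MvPolynomial (Chi r) (ZMod 2)) • π p := by
          rw [Algebra.smul_def, halg, rename_X]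
        rw [h]
        exact Submodule.smul_mem _ _ hp
      · exact mul_mem_span_range_pow (fun w => π (X (highChi w))) hmul w hp
  obtain ⟨c, N, d, h⟩ :=
    exists_eq_add_sum_of_mem_span_range_pow (fun w => π (X (highChi w))) hspan
  refine ⟨c, N, d, Ideal.Quotient.eq.1 (h.trans ?_)⟩
  simp [halg, π]

/-- Extension of a linear form on `W r` with values in `K` to one on `W (r + 1)` sending the new
basis vector to an indeterminate. -/
noncomputable def extendForm {r : ℕ} {K : Type*} [Field K] [Algebra (ZMod 2) K] (f : W r →+ K) :
    W (r + 1) →+ RatFunc K where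
  toFun w := algebraMap (ZMod 2) (RatFunc K) (w 0) * RatFunc.X +
    algebraMap K (RatFunc K) (f (Fin.tail w))
  map_zero' := by
    have : Fin.tail (0 : W (r + 1)) = 0 := rfl
    simp [this]
  map_add' v w := by
    have : Fin.tail (v + w) = Fin.tail v + Fin.tail w := rfl
    simp only [this, map_add, Pi.add_apply]
    ring

section extendForm

variable {r : ℕ} {K : Type*} [Field K] [Algebra (ZMod 2) K] (f : W r →+ K)

lemma extendForm_lowChi (l : Chi r) :
    extendForm f (lowChi l).1 = algebraMap K (RatFunc K) (f l.1) := by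
  simp [extendForm, lowChi]

lemma extendForm_highChi (w : W r) :
    extendForm f (highChi w).1 = RatFunc.X + algebraMap K (RatFunc K) (f w) := by
  simp [extendForm, highChi]

lemma extendForm_injective (hf : Function.Injective f) :
    Function.Injective (extendForm f) := by
  rw [injective_iff_map_eq_zero]
  intro x hx
  by_contra hne
  rcases chi_succ_cases ⟨x, hne⟩ with ⟨l, hl⟩ | ⟨w, hw⟩
  · have hxl : x = (lowChi l).1 := congrArg Subtype.val hl
    rw [hxl, extendForm_lowChi, map_eq_zero, map_eq_zero_iff f hf] at hx
    exact l.2 hx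
  · have hxw : x = (highChi w).1 := congrArg Subtype.val hw
    rw [hxw, extendForm_highChi, IsScalarTower.algebraMap_apply K (Polynomial K) (RatFunc K),
      ← RatFunc.algebraMap_X, ← map_add, Polynomial.algebraMap_eq] at hx
    exact RatFunc.algebraMap_ne_zero (Polynomial.X_add_C_ne_zero _) hx

lemma aeval_extendForm_rename (p : MvPolynomial (Chi r) (ZMod 2)) :
    aeval (R := ZMod 2) (fun l : Chi (r + 1) => (extendForm f l.1)⁻¹) (rename lowChi p) =
      algebraMap K (RatFunc K) (aeval (R := ZMod 2) (fun l : Chi r => (f l.1)⁻¹) p) := by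
  rw [aeval_rename]
  induction p using MvPolynomial.induction_on with
  | C a =>
    simp only [aeval_C]
    exact RingHom.congr_fun (Subsingleton.elim (algebraMap (ZMod 2) (RatFunc K))
      ((algebraMap K (RatFunc K)).comp (algebraMap (ZMod 2) K))) a
  | add p q hp hq => simp only [map_add, hp, hq]
  | mul_X p l hp => simp only [map_mul, hp, aeval_X, Function.comp, extendForm_lowChi, map_inv₀]

lemma ker_aeval_extendForm (hf : Function.Injective f)
    (hker : RingHom.ker (aeval (R := ZMod 2) fun l : Chi r => (f l.1)⁻¹) = hkIdeal r) :
    RingHom.ker (aeval (R := ZMod 2) fun l : Chi (r + 1) => (extendForm f l.1)⁻¹) =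
      hkIdeal (r + 1) := by
  have hle := hkIdeal_le_ker (extendForm f) (extendForm_injective f hf)
  refine le_antisymm (fun p hp => ?_) hle
  obtain ⟨c, N, d, h⟩ := exists_normalForm p
  have h0 := hle h
  rw [RingHom.mem_ker] at hp h0
  rw [map_sub, hp, zero_sub, neg_eq_zero] at h0
  simp only [map_add, map_sum, map_mul, map_pow, aeval_extendForm_rename, aeval_X,
    extendForm_highChi] at h0
  obtain ⟨hc, hd⟩ := partialFraction_eq_zero f hf _ _ h0
  have hmem (q : MvPolynomial (Chi r) (ZMod 2))
      (hq : aeval (R := ZMod 2) (fun l : Chi r => (f l.1)⁻¹) q = 0) :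
      rename lowChi q ∈ hkIdeal (r + 1) :=
    hkIdeal_le_comap_rename r (hker ▸ hq)
  refine (Submodule.sub_mem_iff_left _ ?_).1 h
  exact Ideal.add_mem _ (hmem c hc) (Ideal.sum_mem _ fun w _ => Ideal.sum_mem _ fun j _ =>
    Ideal.mul_mem_right _ _ (hmem _ (hd w j)))

end extendForm

/-- The Holler–Kriz ideal is the ideal of relations between the reciprocals of the nonzero
vectors of an embedded copy of `W r` in some field. -/
theorem exists_ker_aeval_inv_eq_hkIdeal (r : ℕ) :
    ∃ (K : Type) (_ : Field K) (_ : Algebra (ZMod 2) K) (f : W r →+ K), Function.Injective f ∧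
      RingHom.ker (aeval (R := ZMod 2) fun l : Chi r => (f l.1)⁻¹) = hkIdeal r := by
  induction r with
  | zero =>
    have hinj : Function.Injective (0 : W 0 →+ ZMod 2) := Function.injective_of_subsingleton _
    refine ⟨ZMod 2, inferInstance, inferInstance, 0, hinj,
      le_antisymm (fun p hp => ?_) (hkIdeal_le_ker _ hinj)⟩
    have : IsEmpty (Chi 0) := ⟨fun l => l.2 (Subsingleton.elim _ _)⟩
    rw [RingHom.mem_ker, eq_C_of_isEmpty p, aeval_C] at hp
    rw [eq_C_of_isEmpty p, (by simpa using hp : coeff 0 p = 0), map_zero]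
    exact zero_mem _
  | succ r ih =>
    obtain ⟨K, _, _, f, hf, hker⟩ := ih
    exact ⟨RatFunc K, inferInstance, inferInstance, extendForm f, extendForm_injective f hf,
      ker_aeval_extendForm f hf hker⟩

/-- The geometric fixed point ring `Φ^A_*(HF₂) = H(A|A)` in its Holler–Kriz
presentation is an integral domain. -/
theorem stmt14 (r : ℕ) :
    IsDomain (MvPolynomial (Chi r) (ZMod 2) ⧸ hkIdeal r) := by
  obtain ⟨K, _, _, f, -, hker⟩ := exists_ker_aeval_inv_eq_hkIdeal r
  have : (hkIdeal r).IsPrime := hker ▸ RingHom.ker_isPrime _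
  exact Ideal.Quotient.isDomain _
end

section
/- Let R denote the quotient of the polynomial ring MvPolynomial χ (ZMod 2), with one variable e_λ for each λ ∈ χ, by the ideal generated by the linear polynomials e_α + e_β + e_γ for all α, β, γ ∈ χ with α + β + γ = 0. Then the F₂-algebra homomorphism MvPolynomial (Fin r) (ZMod 2) → R sending the i-th variable X_i to the class of e_{δ_i}, where δ_i ∈ χ is the i-th standard basis vector of W, is bijective; in particular R is a polynomial algebra in r variables. (This is the paper's identification of the localization H(A|{1}) of Bredon homology, obtained by inverting all inverse Thom classes, with the polynomial ring on the Euler classes of a basis of characters, i.e. with the group cohomology ring H^*(A; F₂).) -/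
open MvPolynomial

/-- The ideal generated by the linear polynomials `e_α + e_β + e_γ` for all triples of
nonzero vectors with `α + β + γ = 0`. -/
noncomputable def eulIdeal (r : ℕ) : Ideal (MvPolynomial (Chi r) (ZMod 2)) :=
  Ideal.span {p | ∃ α β γ : Chi r, α.val + β.val + γ.val = 0 ∧
    p = X α + X β + X γ}

/-- The `i`-th standard basis vector of `W r`, as a nonzero vector. -/
noncomputable def stdChi {r : ℕ} (i : Fin r) : Chi r :=
  ⟨Pi.single i 1, fun h => one_ne_zero (α := ZMod 2) (by simpa using congrFun h i)⟩

/-- The Euler class of a character in the quotient ring, extended by `0` to the zero vector, as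
an additive map. -/
noncomputable def eulerClass (r : ℕ) :
    W r →+ MvPolynomial (Chi r) (ZMod 2) ⧸ eulIdeal r where
  toFun w := if h : w = 0 then 0 else Ideal.Quotient.mk (eulIdeal r) (X ⟨w, h⟩)
  map_zero' := by simp
  map_add' v w := by
    by_cases hv : v = 0
    · simp [hv]
    by_cases hw : w = 0
    · simp [hw]
    by_cases hvw : v + w = 0
    · obtain rfl : v = w := by
        funext i
        exact CharTwo.add_eq_zero.1 (congrFun hvw i)
      simp only [hvw, hv, dite_true, dite_false, ← map_add, CharTwo.add_self_eq_zero, map_zero]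
    · simp only [hv, hw, hvw, dite_false, ← map_add]
      rw [Ideal.Quotient.mk_eq_mk_iff_sub_mem, CharTwo.sub_eq_add]
      refine Ideal.subset_span ⟨⟨v + w, hvw⟩, ⟨v, hv⟩, ⟨w, hw⟩, ?_, by ring⟩
      rw [add_assoc]
      exact funext fun i => CharTwo.add_self_eq_zero (v i + w i)

theorem eulerClass_val {r : ℕ} (w : Chi r) :
    eulerClass r w.val = Ideal.Quotient.mk (eulIdeal r) (X w) :=
  dif_neg w.2

theorem eulerClass_eq_sum {r : ℕ} (w : W r) :
    eulerClass r w = ∑ i, w i • Ideal.Quotient.mk (eulIdeal r) (X (stdChi i)) := by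
  have h := LinearMap.pi_apply_eq_sum_univ ((eulerClass r).toZModLinearMap 2) w
  simp only [AddMonoidHom.coe_toZModLinearMap] at h
  rw [h]
  refine Finset.sum_congr rfl fun i _ => ?_
  rw [← eulerClass_val]
  congr 2
  ext j
  simp [stdChi, Pi.single_apply, eq_comm]

/-- The retraction sending the class of `e_w` to the linear form `∑ i, w i • X i`. -/
noncomputable def eulerRetraction (r : ℕ) :
    (MvPolynomial (Chi r) (ZMod 2) ⧸ eulIdeal r) →ₐ[ZMod 2] MvPolynomial (Fin r) (ZMod 2) :=
  Ideal.Quotient.liftₐ (eulIdeal r)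
    (aeval fun w : Chi r => ∑ i, w.val i • (X i : MvPolynomial (Fin r) (ZMod 2))) <| by
      intro a ha
      rw [← RingHom.mem_ker]
      refine (Ideal.span_le.2 ?_ : eulIdeal r ≤ _) ha
      rintro p ⟨α, β, γ, h, rfl⟩
      simp only [SetLike.mem_coe, RingHom.mem_ker, map_add, aeval_X, ← Finset.sum_add_distrib,
        ← add_smul]
      refine Finset.sum_eq_zero fun i _ => ?_
      rw [← Pi.add_apply, ← Pi.add_apply, h, Pi.zero_apply, zero_smul]

theorem eulerRetraction_mk_X {r : ℕ} (w : Chi r) :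
    eulerRetraction r (Ideal.Quotient.mk (eulIdeal r) (X w)) = ∑ i, w.val i • X i :=
  aeval_X _ w

/-- The localization `H(A|{1})` of Bredon homology at all inverse Thom classes is the
polynomial ring on the Euler classes of a basis of characters: the algebra map from
`F₂[X_1, …, X_r]` sending `X_i` to the class of `e_{δ_i}` is bijective. -/
theorem stmt15 (r : ℕ) :
    Function.Bijective
      (MvPolynomial.aeval
        (fun i : Fin r => Ideal.Quotient.mk (eulIdeal r) (X (stdChi i))) :
        MvPolynomial (Fin r) (ZMod 2) →ₐ[ZMod 2]
          MvPolynomial (Chi r) (ZMod 2) ⧸ eulIdeal r) := by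
  set f := (MvPolynomial.aeval
    (fun i : Fin r => Ideal.Quotient.mk (eulIdeal r) (X (stdChi i))) :
      MvPolynomial (Fin r) (ZMod 2) →ₐ[ZMod 2]
        MvPolynomial (Chi r) (ZMod 2) ⧸ eulIdeal r) with hf
  have left : (eulerRetraction r).comp f = AlgHom.id (ZMod 2) _ := by
    ext1 i
    rw [AlgHom.comp_apply, hf, aeval_X, eulerRetraction_mk_X]
    simp [stdChi, Pi.single_apply, ite_smul]
  have right : f.comp (eulerRetraction r) = AlgHom.id (ZMod 2) _ := by
    refine Ideal.Quotient.algHom_ext _ (MvPolynomial.algHom_ext fun w => ?_)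
    change f (eulerRetraction r (Ideal.Quotient.mk (eulIdeal r) (X w))) =
      Ideal.Quotient.mk (eulIdeal r) (X w)
    rw [eulerRetraction_mk_X, ← eulerClass_val, eulerClass_eq_sum, map_sum]
    simp only [map_smul, hf, aeval_X]
  exact Function.bijective_iff_has_inverse.2
    ⟨eulerRetraction r, DFunLike.congr_fun left, DFunLike.congr_fun right⟩
end
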